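/- Let (R, m) be a commutative Noetherian local ring. Then R is Gorenstein if and only if the following two conditions hold: (a) for any parameter ideals a and b of R with b ⊆ a, the R-module Hom_R(R/a, R/b) is cyclic; and (b) there exists an irreducible parameter ideal of R. -/

import Mathlib

open IsLocalRing

/-- A parameter ideal of a Noetherian local ring: an ideal generated by a system of
parameters, i.e. by `d` elements of the maximal ideal (where `d` is the Krull dimension
of the ring) generating an ideal whose radical is the maximal ideal. -/
def IsParameterIdeal (R : Type*) [CommRing R] [IsLocalRing R] (I : Ideal R) : Prop :=
  ∃ (d : ℕ) (a : Fin d → R), ringKrullDim R = d ∧ (∀ i, a i ∈ maximalIdeal R) ∧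
    I = Ideal.span (Set.range a) ∧ I.radical = maximalIdeal R

/-- A ring is Gorenstein if it has finite injective dimension as a module over itself,
i.e. it admits an injective resolution vanishing in all sufficiently large degrees. -/
def HasFiniteInjectiveDimension (R : Type*) [CommRing R] : Prop :=
  ∃ (n : ℕ) (J : CategoryTheory.InjectiveResolution (ModuleCat.of R R)),
    ∀ i, n < i → CategoryTheory.Limits.IsZero (J.cocomplex.X i)

/-- An ideal is irreducible if it is proper and whenever it is the intersection of two
ideals it equals one of them. -/
def IsIrreducibleIdeal {R : Type*} [CommRing R] (I : Ideal R) : Prop :=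
  I ≠ ⊤ ∧ ∀ J K : Ideal R, I = J ⊓ K → I = J ∨ I = K



open CategoryTheory Abelian

universe u

/-- Vanishing of `Ext^i_R(N, M)`. -/
abbrev ExtVanishes (R : Type u) [CommRing R] (N M : Type u) [AddCommGroup N] [Module R N]
    [AddCommGroup M] [Module R M] (i : ℕ) : Prop :=
  Subsingleton (Ext (ModuleCat.of R N) (ModuleCat.of R M) i)

section LongExactSequences

variable {R : Type u} [CommRing R] {N M M₁ M₂ M₃ N₁ N₂ N₃ : Type u}
  [AddCommGroup N] [Module R N] [AddCommGroup M] [Module R M]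
  [AddCommGroup M₁] [Module R M₁] [AddCommGroup M₂] [Module R M₂] [AddCommGroup M₃] [Module R M₃]
  [AddCommGroup N₁] [Module R N₁] [AddCommGroup N₂] [Module R N₂] [AddCommGroup N₃] [Module R N₃]

lemma moduleCat_shortExact {f : M₁ →ₗ[R] M₂} {g : M₂ →ₗ[R] M₃} (hf : Function.Injective f)
    (hfg : Function.Exact f g) (hg : Function.Surjective g) :
    (ModuleCat.shortComplexOfCompEqZero f g hfg.linearMap_comp_eq_zero).ShortExact :=
  ModuleCat.shortComplex_shortExact _ hfg hf hg

lemma ExtVanishes.congr_left (e : N₁ ≃ₗ[R] N₂) {i : ℕ} (h : ExtVanishes R N₁ M i) :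
    ExtVanishes R N₂ M i := by
  refine ⟨fun a b => ?_⟩
  have key : ∀ c : Ext (ModuleCat.of R N₂) (ModuleCat.of R M) i, c = 0 := by
    intro c
    have h1 : (Ext.mk₀ e.symm.toModuleIso.hom).comp
        ((Ext.mk₀ e.toModuleIso.hom).comp c (zero_add i)) (zero_add i) = c := by
      rw [← Ext.comp_assoc_of_second_deg_zero, Ext.mk₀_comp_mk₀]
      have : e.symm.toModuleIso.hom ≫ e.toModuleIso.hom = 𝟙 _ := by
        ext x; simp
      rw [this, Ext.mk₀_id_comp]
    rw [← h1, Subsingleton.elim ((Ext.mk₀ e.toModuleIso.hom).comp c (zero_add i)) 0, Ext.comp_zero]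
  rw [key a, key b]

lemma ExtVanishes.of_injective_right [Module.Injective R M] (i : ℕ) :
    ExtVanishes R N M (i + 1) := by
  have := Module.injective_object_of_injective_module R M
  exact ⟨fun a b => by rw [Ext.eq_zero_of_injective a, Ext.eq_zero_of_injective b]⟩

lemma ExtVanishes.of_self_left (i : ℕ) : ExtVanishes R R M (i + 1) := by
  have : Projective (ModuleCat.of R R) := inferInstance
  exact ⟨fun a b => by rw [Ext.eq_zero_of_projective a, Ext.eq_zero_of_projective b]⟩

lemma extVanishes_succ_iff_of_injective_middle [Module.Injective R M₂]
    {f : M₁ →ₗ[R] M₂} {g : M₂ →ₗ[R] M₃} (hf : Function.Injective f)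
    (hfg : Function.Exact f g) (hg : Function.Surjective g)
    (i : ℕ) :
    ExtVanishes R N M₃ (i + 1) ↔ ExtVanishes R N M₁ (i + 2) := by
  have S := moduleCat_shortExact hf hfg hg
  have h2 := fun j => ExtVanishes.of_injective_right (R := R) (N := N) (M := M₂) j
  have h2' := h2 i
  have h2'' := h2 (i + 1)
  constructor
  · intro h
    refine subsingleton_of_forall_eq 0 fun x => ?_
    obtain ⟨y, rfl⟩ := Ext.covariant_sequence_exact₁ _ S x (h2''.elim _ _) (n₀ := i + 1) rfl
    rw [h.elim y 0, Ext.zero_comp]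
  · intro h
    refine subsingleton_of_forall_eq 0 fun x => ?_
    obtain ⟨y, rfl⟩ := Ext.covariant_sequence_exact₃ _ S x (n₁ := i + 2) rfl (h.elim _ _)
    rw [h2'.elim y 0, Ext.zero_comp]

lemma extVanishes_iff_of_injective_left [Module.Injective R M₁]
    {f : M₁ →ₗ[R] M₂} {g : M₂ →ₗ[R] M₃} (hf : Function.Injective f)
    (hfg : Function.Exact f g) (hg : Function.Surjective g)
    (i : ℕ) :
    ExtVanishes R N M₂ (i + 1) ↔ ExtVanishes R N M₃ (i + 1) := by
  have S := moduleCat_shortExact hf hfg hg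
  have h1 := ExtVanishes.of_injective_right (R := R) (N := N) (M := M₁) i
  have h1' := ExtVanishes.of_injective_right (R := R) (N := N) (M := M₁) (i + 1)
  constructor
  · intro h
    refine subsingleton_of_forall_eq 0 fun x => ?_
    obtain ⟨y, rfl⟩ := Ext.covariant_sequence_exact₃ _ S x (n₁ := i + 2) rfl (h1'.elim _ _)
    rw [h.elim y 0, Ext.zero_comp]
  · intro h
    refine subsingleton_of_forall_eq 0 fun x => ?_
    obtain ⟨y, rfl⟩ := Ext.covariant_sequence_exact₂ _ S x (h.elim _ _)
    rw [h1.elim y 0, Ext.zero_comp]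

lemma extVanishes_one_iff_of_injective_middle [Module.Injective R M₂]
    {f : M₁ →ₗ[R] M₂} {g : M₂ →ₗ[R] M₃} (hf : Function.Injective f)
    (hfg : Function.Exact f g) (hg : Function.Surjective g)
    :
    ExtVanishes R N M₁ 1 ↔ ∀ φ : N →ₗ[R] M₃, ∃ ψ : N →ₗ[R] M₂, g ∘ₗ ψ = φ := by
  have S := moduleCat_shortExact hf hfg hg
  have h2 := ExtVanishes.of_injective_right (R := R) (N := N) (M := M₂) 0
  constructor
  · intro h φ
    obtain ⟨y, hy⟩ := Ext.covariant_sequence_exact₃ _ S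
      (Ext.mk₀ (X := ModuleCat.of R N) (Y := ModuleCat.of R M₃) (ModuleCat.ofHom φ))
      (n₁ := 1) rfl (h.elim _ _)
    obtain ⟨ψ, rfl⟩ := Ext.homEquiv₀.symm.surjective y
    refine ⟨ψ.hom, ?_⟩
    have : ψ ≫ ModuleCat.ofHom g = ModuleCat.ofHom φ :=
      Ext.homEquiv₀.symm.injective (by simpa using hy)
    ext x
    simpa using LinearMap.congr_fun (congrArg ModuleCat.Hom.hom this) x
  · intro h
    refine subsingleton_of_forall_eq 0 fun x => ?_
    obtain ⟨y, rfl⟩ := Ext.covariant_sequence_exact₁ _ S x (h2.elim _ _) (n₀ := 0) rfl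
    obtain ⟨φ, rfl⟩ := Ext.homEquiv₀.symm.surjective y
    obtain ⟨ψ, hψ⟩ := h φ.hom
    have : φ = (ModuleCat.ofHom ψ : ModuleCat.of R N ⟶ ModuleCat.of R M₂) ≫ ModuleCat.ofHom g := by
      ext x
      simp [← hψ]
    subst this
    have h0 := S.comp_extClass
    simp only [Ext.homEquiv₀_symm_apply]
    have h1 : (Ext.mk₀ ((ModuleCat.ofHom ψ : ModuleCat.of R N ⟶ ModuleCat.of R M₂) ≫
        ModuleCat.ofHom g)).comp S.extClass (zero_add 1) =
        (Ext.mk₀ (ModuleCat.ofHom ψ : ModuleCat.of R N ⟶ ModuleCat.of R M₂)).comp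
          ((Ext.mk₀ (ModuleCat.ofHom g)).comp S.extClass (zero_add 1)) (zero_add 1) := by
      rw [← Ext.mk₀_comp_mk₀, Ext.comp_assoc_of_second_deg_zero]
    exact h1.trans (by
      rw [show (Ext.mk₀ (ModuleCat.ofHom g)).comp S.extClass (zero_add 1) = 0 from h0,
        Ext.comp_zero])

lemma ExtVanishes.middle
    {f : N₁ →ₗ[R] N₂} {g : N₂ →ₗ[R] N₃} (hf : Function.Injective f)
    (hfg : Function.Exact f g) (hg : Function.Surjective g)
    {i : ℕ} (h1 : ExtVanishes R N₁ M i) (h3 : ExtVanishes R N₃ M i) :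
    ExtVanishes R N₂ M i := by
  have S := moduleCat_shortExact hf hfg hg
  refine subsingleton_of_forall_eq 0 fun x => ?_
  obtain ⟨y, rfl⟩ := Ext.contravariant_sequence_exact₂ S (ModuleCat.of R M) x (h1.elim _ _)
  rw [h3.elim y 0, Ext.comp_zero]

lemma ExtVanishes.left
    {f : N₁ →ₗ[R] N₂} {g : N₂ →ₗ[R] N₃} (hf : Function.Injective f)
    (hfg : Function.Exact f g) (hg : Function.Surjective g)
    {i : ℕ} (h2 : ExtVanishes R N₂ M i) (h3 : ExtVanishes R N₃ M (i + 1)) :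
    ExtVanishes R N₁ M i := by
  have S := moduleCat_shortExact hf hfg hg
  refine subsingleton_of_forall_eq 0 fun x => ?_
  obtain ⟨y, rfl⟩ := Ext.contravariant_sequence_exact₁ S (ModuleCat.of R M) x (add_comm 1 i) (h3.elim _ _)
  rw [h2.elim y 0, Ext.comp_zero]

end LongExactSequences

lemma ExtVanishes.of_regular {R : Type u} [CommRing R] [IsNoetherianRing R] [IsLocalRing R]
    {N M N' : Type u}
    [AddCommGroup N] [Module R N] [AddCommGroup M] [Module R M] [Module.Finite R N]
    [Module.Finite R M] [AddCommGroup N'] [Module R N']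
    {x : R} (hx : x ∈ maximalIdeal R) {g : N →ₗ[R] N'} (hreg : Function.Injective (LinearMap.lsmul R N x))
    (hex : Function.Exact (LinearMap.lsmul R N x) g) (hg : Function.Surjective g)
    {i : ℕ} (h : ExtVanishes R N' M (i + 1)) : ExtVanishes R N M i := by
  have S := moduleCat_shortExact hreg hex hg
  have key : ∀ a : Ext (ModuleCat.of R N) (ModuleCat.of R M) i, ∃ b, x • b = a := by
    intro a
    obtain ⟨y, rfl⟩ := Ext.contravariant_sequence_exact₁ S (ModuleCat.of R M) a (add_comm 1 i) (h.elim _ _)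
    refine ⟨y, ?_⟩
    change x • y = (Ext.mk₀ (x • 𝟙 (ModuleCat.of R N))).comp y (zero_add i)
    simp [Ext.mk₀_smul]
  have : (⊤ : Submodule R (Ext (ModuleCat.of R N) (ModuleCat.of R M) i)) = ⊥ := by
    refine Submodule.eq_bot_of_le_smul_of_le_jacobson_bot (maximalIdeal R) _ Module.Finite.fg_top ?_
      (IsLocalRing.maximalIdeal_le_jacobson _)
    intro a _
    obtain ⟨b, rfl⟩ := key a
    exact Submodule.smul_mem_smul hx trivial
  exact (Submodule.subsingleton_iff R).mp (subsingleton_of_bot_eq_top this.symm)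


section ResidueField

variable {R : Type u} [CommRing R]

lemma exact_lsmul_factor (I : Ideal R) (x : R) :
    Function.Exact (LinearMap.lsmul R (R ⧸ I) x)
      (Submodule.factor (le_sup_left : I ≤ I ⊔ Ideal.span {x})) := by
  intro y
  obtain ⟨y, rfl⟩ := Submodule.Quotient.mk_surjective _ y
  change (Submodule.Quotient.mk y : R ⧸ I ⊔ Ideal.span {x}) = 0 ↔ _
  rw [Submodule.Quotient.mk_eq_zero, Submodule.mem_sup]
  constructor
  · rintro ⟨a, ha, b, hb, rfl⟩
    obtain ⟨c, rfl⟩ := Ideal.mem_span_singleton'.mp hb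
    refine ⟨Submodule.Quotient.mk c, ?_⟩
    rw [LinearMap.lsmul_apply, ← Submodule.Quotient.mk_smul, Submodule.Quotient.eq]
    have : x • c - (a + c * x) = - a := by rw [smul_eq_mul]; ring
    rw [this]
    exact neg_mem ha
  · rintro ⟨c, hc⟩
    obtain ⟨c, rfl⟩ := Submodule.Quotient.mk_surjective _ c
    rw [LinearMap.lsmul_apply, ← Submodule.Quotient.mk_smul, Submodule.Quotient.eq] at hc
    refine ⟨y - x * c, ?_, x * c, Ideal.mul_mem_right _ _ (Ideal.mem_span_singleton_self x),
      by ring⟩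
    simpa using neg_mem hc

/-- Multiplication by `x` as an injection `R ⧸ (I : x) → R ⧸ I`. -/
def mulQuotientColon (I : Ideal R) (x : R) :
    (R ⧸ Submodule.comap (LinearMap.lsmul R R x) I) →ₗ[R] (R ⧸ I) :=
  Submodule.mapQ _ _ (LinearMap.lsmul R R x) le_rfl

lemma mulQuotientColon_injective (I : Ideal R) (x : R) :
    Function.Injective (mulQuotientColon I x) := by
  rw [← LinearMap.ker_eq_bot, mulQuotientColon, Submodule.ker_mapQ, Submodule.mkQ_map_self]

lemma exact_mulQuotientColon_factor (I : Ideal R) (x : R) :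
    Function.Exact (mulQuotientColon I x)
      (Submodule.factor (le_sup_left : I ≤ I ⊔ Ideal.span {x})) := by
  intro y
  rw [exact_lsmul_factor I x y]
  constructor
  · rintro ⟨c, rfl⟩
    obtain ⟨c, rfl⟩ := Submodule.Quotient.mk_surjective _ c
    exact ⟨Submodule.Quotient.mk c, rfl⟩
  · rintro ⟨c, rfl⟩
    obtain ⟨c, rfl⟩ := Submodule.Quotient.mk_surjective _ c
    exact ⟨Submodule.Quotient.mk c, rfl⟩

lemma extVanishes_quotient_of_residueField [IsNoetherianRing R] [IsLocalRing R] {M : Type u}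
    [AddCommGroup M] [Module R M] [Module.Finite R M] {N : ℕ}
    (h : ∀ i ≥ N, ExtVanishes R (ResidueField R) M i) (I : Ideal R) :
    ∀ i ≥ N, ExtVanishes R (R ⧸ I) M i := by
  induction I using IsNoetherian.induction with
  | hgt I ih =>
    intro i hi
    by_cases hI : I = ⊤
    · have : Subsingleton (R ⧸ I) := Submodule.Quotient.subsingleton_iff.mpr hI
      have hz : Limits.IsZero (ModuleCat.of R (R ⧸ I)) := ModuleCat.isZero_of_subsingleton _
      refine subsingleton_of_forall_eq 0 fun x => ?_
      rw [← Ext.mk₀_id_comp x, hz.eq_of_src (𝟙 _) 0, Ext.mk₀_zero, Ext.zero_comp]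
    by_cases hm : I = maximalIdeal R
    · subst hm
      exact h i hi
    obtain ⟨x, hxm, hxI⟩ := SetLike.exists_of_lt
      (lt_of_le_of_ne (IsLocalRing.le_maximalIdeal hI) hm)
    have hlt : I < I ⊔ Ideal.span {x} := by
      refine lt_of_le_of_ne le_sup_left fun heq => hxI ?_
      rw [heq]
      exact Ideal.mem_sup_right (Ideal.mem_span_singleton_self x)
    have hle : I ≤ Submodule.comap (LinearMap.lsmul R R x) I := fun r hr => by
      simpa using Ideal.mul_mem_left I x hr
    by_cases hK : Submodule.comap (LinearMap.lsmul R R x) I = I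
    · refine ExtVanishes.of_regular hxm ?_ (exact_lsmul_factor I x)
        (Submodule.factor_surjective _) (ih _ hlt (i + 1) (by lia))
      rw [← LinearMap.ker_eq_bot, LinearMap.ker_eq_bot']
      intro c hc
      obtain ⟨c, rfl⟩ := Submodule.Quotient.mk_surjective _ c
      rw [LinearMap.lsmul_apply, ← Submodule.Quotient.mk_smul, Submodule.Quotient.mk_eq_zero] at hc
      rw [Submodule.Quotient.mk_eq_zero, ← hK]
      exact hc
    · exact ExtVanishes.middle (mulQuotientColon_injective I x)
        (exact_mulQuotientColon_factor I x) (Submodule.factor_surjective _)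
        (ih _ (lt_of_le_of_ne hle (Ne.symm hK)) i hi) (ih _ hlt i hi)

lemma injective_of_extVanishes_one {M : Type u} [AddCommGroup M] [Module R M]
    (h : ∀ I : Ideal R, ExtVanishes R (R ⧸ I) M 1) : Module.Injective R M := by
  refine Module.Baer.injective fun I g => ?_
  have S := moduleCat_shortExact (Submodule.subtype_injective I)
    (LinearMap.exact_subtype_mkQ I) (Submodule.mkQ_surjective I)
  obtain ⟨y, hy⟩ := Ext.contravariant_sequence_exact₁ S (ModuleCat.of R M)
    (Ext.mk₀ (X := ModuleCat.of R I) (Y := ModuleCat.of R M) (ModuleCat.ofHom g))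
    (add_zero 1) ((h I).elim _ _)
  obtain ⟨ψ, rfl⟩ := Ext.homEquiv₀.symm.surjective y
  refine ⟨ψ.hom, fun x hx => ?_⟩
  have : ModuleCat.ofHom I.subtype ≫ ψ = ModuleCat.ofHom g :=
    Ext.homEquiv₀.symm.injective (by simpa using hy)
  simpa using LinearMap.congr_fun (congrArg ModuleCat.Hom.hom this) ⟨x, hx⟩

end ResidueField

lemma exists_injective_embedding (R : Type u) [CommRing R] (M : Type u) [AddCommGroup M]
    [Module R M] : ∃ (E : ModuleCat.{u} R) (f : M →ₗ[R] E), Module.Injective R E ∧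
      Function.Injective f := by
  obtain ⟨E⟩ := (inferInstance : EnoughInjectives (ModuleCat.{u} R)).presentation
    (ModuleCat.of R M)
  have hE := E.injective
  refine ⟨E.J, E.f.hom, Module.injective_module_of_injective_object R E.J, ?_⟩
  exact (ModuleCat.mono_iff_injective E.f).mp E.mono


section Resolution

open Limits

variable {C : Type*} [Category* C] [Abelian C]

lemma exists_injectiveResolution_of_exact {Z : C} (K : CochainComplex C ℕ)
    (hK : ∀ n, Injective (K.X n)) (i : Z ⟶ K.X 0) [Mono i] (hi : i ≫ K.d 0 1 = 0)
    (h0 : (ShortComplex.mk i (K.d 0 1) hi).Exact)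
    (h1 : ∀ n, (ShortComplex.mk _ _ (K.d_comp_d n (n + 1) (n + 2))).Exact) :
    ∃ J : InjectiveResolution Z, J.cocomplex = K := by
  let ι : (CochainComplex.single₀ C).obj Z ⟶ K := (CochainComplex.fromSingle₀Equiv _ _).symm ⟨i, hi⟩
  have hι : ι.f 0 = i := by simp [ι]
  have : QuasiIso ι := ⟨fun n => by
    cases n
    · rw [CochainComplex.quasiIsoAt₀_iff, ShortComplex.quasiIso_iff_of_zeros]
      · refine (ShortComplex.exact_and_mono_f_iff_of_iso ?_).2 ⟨h0, inferInstanceAs (Mono i)⟩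
        exact ShortComplex.isoMk (Iso.refl _) (Iso.refl _) (Iso.refl _)
          (by exact (Category.id_comp _).trans (hι.symm.trans (Category.comp_id _).symm))
          (by exact (Category.id_comp _).trans (Category.comp_id _).symm)
      all_goals first | rfl | exact K.shape 0 0 (by simp)
    · rename_i n
      rw [quasiIsoAt_iff_exactAt]
      · exact (HomologicalComplex.exactAt_iff' _ n (n + 1) (n + 2) (by simp)
          (by simp only [CochainComplex.next]; rfl)).2 (h1 n)
      · apply CochainComplex.exactAt_succ_single_obj⟩
  exact ⟨{ cocomplex := K, injective := hK, ι := ι }, rfl⟩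

lemma exists_injectiveResolution_of_shortExact {S : ShortComplex C} (hS : S.ShortExact)
    [Injective S.X₂] (J : InjectiveResolution S.X₃) :
    ∃ J' : InjectiveResolution S.X₁, ∀ n, IsZero (J.cocomplex.X n) →
      IsZero (J'.cocomplex.X (n + 1)) := by
  have hJ : J.ι.f 0 ≫ J.cocomplex.d 0 1 = 0 := J.ι_f_zero_comp_complex_d
  let j : S.X₃ ⟶ J.cocomplex.X 0 := J.ι.f 0
  have hj : j ≫ J.cocomplex.d 0 1 = 0 := hJ
  have hjm : Mono j := inferInstanceAs (Mono (J.ι.f 0))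
  have hjex : (ShortComplex.mk j (J.cocomplex.d 0 1) hj).Exact := J.exact₀
  let K := CochainComplex.augment J.cocomplex (S.g ≫ j) (by simp [hj])
  have hz : S.f ≫ K.d 0 1 = 0 := by
    change S.f ≫ S.g ≫ j = 0
    simp
  let i : S.X₁ ⟶ K.X 0 := S.f
  have hi : Mono i := hS.mono_f
  have h0 : (ShortComplex.mk S.f (S.g ≫ j) hz).Exact := by
    let φ : S ⟶ ShortComplex.mk S.f (S.g ≫ j) hz := { τ₁ := 𝟙 _, τ₂ := 𝟙 _, τ₃ := j }
    have : Epi φ.τ₁ := inferInstanceAs (Epi (𝟙 S.X₁))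
    have : IsIso φ.τ₂ := inferInstanceAs (IsIso (𝟙 S.X₂))
    have : Mono φ.τ₃ := hjm
    exact (ShortComplex.exact_iff_of_epi_of_isIso_of_mono φ).mp hS.exact
  have hz' : (S.g ≫ j) ≫ J.cocomplex.d 0 1 = 0 := by simp [hj]
  have h1 : (ShortComplex.mk (S.g ≫ j) (J.cocomplex.d 0 1) hz').Exact := by
    let φ : ShortComplex.mk (S.g ≫ j) (J.cocomplex.d 0 1) hz' ⟶
        ShortComplex.mk j (J.cocomplex.d 0 1) hj := { τ₁ := S.g, τ₂ := 𝟙 _, τ₃ := 𝟙 _ }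
    have : Epi φ.τ₁ := hS.epi_g
    have : IsIso φ.τ₂ := inferInstanceAs (IsIso (𝟙 (J.cocomplex.X 0)))
    have : Mono φ.τ₃ := inferInstanceAs (Mono (𝟙 (J.cocomplex.X 1)))
    exact (ShortComplex.exact_iff_of_epi_of_isIso_of_mono φ).mpr hjex
  have hK : ∀ n, Injective (K.X n) := fun n => by
    cases n
    · exact inferInstanceAs (Injective S.X₂)
    · exact J.injective _
  obtain ⟨J', hJ'⟩ := exists_injectiveResolution_of_exact K hK i hz h0 fun n => by
    cases n
    · exact h1
    · exact J.exact_succ _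
  refine ⟨J', fun n hn => ?_⟩
  rw [hJ']
  exact hn

end Resolution

section FiniteInjectiveDimension

variable {R : Type u} [CommRing R]

lemma exists_injectiveResolution_of_extVanishes (N : ℕ) {M : Type u} [AddCommGroup M] [Module R M]
    (h : ∀ I : Ideal R, ∀ i > N, ExtVanishes R (R ⧸ I) M i) :
    ∃ J : InjectiveResolution (ModuleCat.of R M), ∀ i > N, Limits.IsZero (J.cocomplex.X i) := by
  induction N generalizing M with
  | zero =>
    have := injective_of_extVanishes_one fun I => h I 1 (by lia)
    have := Module.injective_object_of_injective_module R M
    refine ⟨InjectiveResolution.self (ModuleCat.of R M), fun i hi => ?_⟩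
    obtain ⟨i, rfl⟩ := Nat.exists_eq_succ_of_ne_zero (by lia : i ≠ 0)
    exact HomologicalComplex.isZero_single_obj_X _ _ _ _ (by simp)
  | succ N ih =>
    obtain ⟨E, f, hE, hf⟩ := exists_injective_embedding R M
    have hex : Function.Exact f (LinearMap.range f).mkQ := LinearMap.exact_map_mkQ_range f
    have hsurj := Submodule.mkQ_surjective (LinearMap.range f)
    obtain ⟨J, hJ⟩ := ih (M := E ⧸ LinearMap.range f) (fun I i hi => by
      obtain ⟨i, rfl⟩ := Nat.exists_eq_succ_of_ne_zero (by lia : i ≠ 0)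
      exact (extVanishes_succ_iff_of_injective_middle hf hex hsurj i).mpr (h I _ (by lia)))
    have hE' := Module.injective_object_of_injective_module R E
    have S := moduleCat_shortExact hf hex hsurj
    have : Injective (ModuleCat.shortComplexOfCompEqZero f (LinearMap.range f).mkQ
      hex.linearMap_comp_eq_zero).X₂ := hE'
    obtain ⟨J', hJ'⟩ := exists_injectiveResolution_of_shortExact S J
    refine ⟨J', fun i hi => ?_⟩
    obtain ⟨i, rfl⟩ := Nat.exists_eq_succ_of_ne_zero (by lia : i ≠ 0)
    exact hJ' _ (hJ _ (by lia))

lemma extVanishes_of_injectiveResolution {N M : Type u} [AddCommGroup N] [Module R N]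
    [AddCommGroup M] [Module R M] (J : InjectiveResolution (ModuleCat.of R M)) {i : ℕ}
    (hJ : Limits.IsZero (J.cocomplex.X i)) : ExtVanishes R N M i := by
  refine subsingleton_of_forall_eq 0 fun x => ?_
  obtain ⟨f, hf, rfl⟩ := J.extMk_surjective x (i + 1) rfl
  obtain rfl := hJ.eq_of_tgt f 0
  exact J.extMk_zero _ _

/-- Vanishing of `Ext^i(k, R)` in all large degrees, where `k` is the residue field. -/
def ResidueExtVanishes (R : Type u) [CommRing R] [IsLocalRing R] : Prop :=
  ∃ n, ∀ i ≥ n, ExtVanishes R (ResidueField R) R i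

lemma hasFiniteInjectiveDimension_iff_residueExtVanishes [IsNoetherianRing R] [IsLocalRing R] :
    HasFiniteInjectiveDimension R ↔ ResidueExtVanishes R := by
  constructor
  · rintro ⟨n, J, hJ⟩
    exact ⟨n + 1, fun i hi => extVanishes_of_injectiveResolution J (hJ i hi)⟩
  · rintro ⟨n, hn⟩
    obtain ⟨J, hJ⟩ := exists_injectiveResolution_of_extVanishes (R := R) n
      fun I i hi => extVanishes_quotient_of_residueField hn I i (by lia)
    exact ⟨n, J, hJ⟩

end FiniteInjectiveDimension


section Socle

variable {R : Type u} [CommRing R] [IsLocalRing R]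

/-- `σ` generates the socle of `R ⧸ I`, and this socle is nonzero. -/
structure IsSocleGenerator (I : Ideal R) (σ : R) : Prop where
  notMem : σ ∉ I
  mul_mem : ∀ x ∈ maximalIdeal R, x * σ ∈ I
  exists_sub_mem : ∀ y, (∀ x ∈ maximalIdeal R, x * y ∈ I) → ∃ c, y - c * σ ∈ I

lemma isUnit_of_mul_notMem {I : Ideal R} {y c : R} (hy : ∀ x ∈ maximalIdeal R, x * y ∈ I)
    (hc : c * y ∉ I) : IsUnit c := by
  by_contra h
  exact hc (hy c ((mem_maximalIdeal c).mpr h))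

lemma exists_mul_notMem_of_pow_le {I : Ideal R} {k : ℕ} (hk : maximalIdeal R ^ k ≤ I) {a : R}
    (ha : a ∉ I) : ∃ r, r * a ∉ I ∧ ∀ x ∈ maximalIdeal R, x * (r * a) ∈ I := by
  classical
  have hex : ∃ k, ∀ r ∈ maximalIdeal R ^ k, r * a ∈ I :=
    ⟨k, fun r hr => I.mul_mem_right _ (hk hr)⟩
  obtain ⟨n, hn⟩ : ∃ n, Nat.find hex = n + 1 := by
    refine Nat.exists_eq_succ_of_ne_zero fun h0 => ha ?_
    have := Nat.find_spec hex
    rw [h0] at this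
    simpa using this 1 (by simp)
  have h1 := Nat.find_spec hex
  have h2 := Nat.find_min hex (m := n) (by lia)
  push Not at h2
  obtain ⟨r, hr, hra⟩ := h2
  refine ⟨r, hra, fun x hx => ?_⟩
  rw [← mul_assoc]
  refine h1 _ ?_
  rw [hn, pow_succ']
  exact Ideal.mul_mem_mul hx hr

lemma IsIrreducibleIdeal.exists_isSocleGenerator {I : Ideal R} (hI : IsIrreducibleIdeal I) {k : ℕ}
    (hk : maximalIdeal R ^ k ≤ I) : ∃ σ, IsSocleGenerator I σ := by
  obtain ⟨σ, hσ, hmσ⟩ := exists_mul_notMem_of_pow_le hk ((Ideal.ne_top_iff_one I).mp hI.1)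
  rw [mul_one] at hσ hmσ
  refine ⟨σ, hσ, hmσ, fun y hy => ?_⟩
  by_cases hyI : y ∈ I
  · exact ⟨0, by simpa using hyI⟩
  have hne : ¬ ((I ⊔ Ideal.span {σ}) ⊓ (I ⊔ Ideal.span {y}) ≤ I) := by
    intro hle
    rcases hI.2 _ _ (le_antisymm (le_inf le_sup_left le_sup_left) hle) with h | h
    · exact hσ (h.ge (Ideal.mem_sup_right (Ideal.mem_span_singleton_self σ)))
    · exact hyI (h.ge (Ideal.mem_sup_right (Ideal.mem_span_singleton_self y)))
  obtain ⟨z, hz, hzI⟩ := SetLike.not_le_iff_exists.mp hne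
  obtain ⟨hz1, hz2⟩ := Submodule.mem_inf.mp hz
  obtain ⟨i, hi, z1, hz1, h1⟩ := Submodule.mem_sup.mp hz1
  obtain ⟨j, hj, z2, hz2, h2⟩ := Submodule.mem_sup.mp hz2
  obtain ⟨c, rfl⟩ := Ideal.mem_span_singleton'.mp hz1
  obtain ⟨d, rfl⟩ := Ideal.mem_span_singleton'.mp hz2
  have hd : IsUnit d := isUnit_of_mul_notMem hy fun hd => hzI (by
    rw [← h2]; exact I.add_mem hj hd)
  obtain ⟨u, rfl⟩ := hd
  refine ⟨↑u⁻¹ * c, ?_⟩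
  have : y - ↑u⁻¹ * c * σ = ↑u⁻¹ * (i - j) := by
    have h3 : (↑u⁻¹ : R) * ↑u = 1 := u.inv_mul
    linear_combination (-y) * h3 + (↑u⁻¹ : R) * h2 - (↑u⁻¹ : R) * h1
  rw [this]
  exact I.mul_mem_left _ (I.sub_mem hi hj)

lemma IsSocleGenerator.isUnit_of_mul_notMem {I : Ideal R} {σ c : R} (h : IsSocleGenerator I σ)
    (hc : c * σ ∉ I) : IsUnit c :=
  _root_.isUnit_of_mul_notMem h.mul_mem hc

lemma IsSocleGenerator.exists_mul_sub_mem {I : Ideal R} {σ : R} (h : IsSocleGenerator I σ) {k : ℕ}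
    (hk : maximalIdeal R ^ k ≤ I) {a : R} (ha : a ∉ I) : ∃ r, r * a - σ ∈ I := by
  obtain ⟨r, hr, hmr⟩ := exists_mul_notMem_of_pow_le hk ha
  obtain ⟨c, hc⟩ := h.exists_sub_mem _ hmr
  obtain ⟨u, rfl⟩ := h.isUnit_of_mul_notMem (c := c) fun hcσ => hr (by
    simpa using I.add_mem hc hcσ)
  refine ⟨↑u⁻¹ * r, ?_⟩
  have : ↑u⁻¹ * r * a - σ = ↑u⁻¹ * (r * a - ↑u * σ) := by
    have h1 : (↑u⁻¹ : R) * ↑u = 1 := u.inv_mul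
    linear_combination σ * h1
  rw [this]
  exact I.mul_mem_left _ hc

lemma IsSocleGenerator.isIrreducibleIdeal {I : Ideal R} {σ : R} (h : IsSocleGenerator I σ) {k : ℕ}
    (hk : maximalIdeal R ^ k ≤ I) : IsIrreducibleIdeal I := by
  have key : ∀ J : Ideal R, I ≤ J → J ≠ I → σ ∈ J := by
    intro J hJ hne
    obtain ⟨a, haJ, haI⟩ := SetLike.exists_of_lt (lt_of_le_of_ne hJ (Ne.symm hne))
    obtain ⟨r, hr⟩ := h.exists_mul_sub_mem hk haI
    have : σ = r * a - (r * a - σ) := by ring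
    rw [this]
    exact J.sub_mem (J.mul_mem_left r haJ) (hJ hr)
  refine ⟨fun htop => h.notMem (htop ▸ trivial), fun J K hJK => ?_⟩
  by_contra! hne
  refine h.notMem ?_
  rw [hJK]
  exact ⟨key J (hJK ▸ inf_le_left) hne.1.symm, key K (hJK ▸ inf_le_right) hne.2.symm⟩

lemma mk_mem_maximalIdeal_iff {I : Ideal R} [IsLocalRing (R ⧸ I)] {x : R} :
    Ideal.Quotient.mk I x ∈ maximalIdeal (R ⧸ I) ↔ x ∈ maximalIdeal R := by
  have := Ideal.comap_isMaximal_of_surjective (Ideal.Quotient.mk I) Ideal.Quotient.mk_surjective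
    (K := maximalIdeal (R ⧸ I))
  rw [← eq_maximalIdeal this, Ideal.mem_comap]

lemma map_mk_maximalIdeal (I : Ideal R) [IsLocalRing (R ⧸ I)] :
    (maximalIdeal R).map (Ideal.Quotient.mk I) = maximalIdeal (R ⧸ I) := by
  refine le_antisymm (Ideal.map_le_iff_le_comap.mpr fun x hx =>
    mk_mem_maximalIdeal_iff.mpr hx) fun x hx => ?_
  obtain ⟨x, rfl⟩ := Ideal.Quotient.mk_surjective x
  exact Ideal.mem_map_of_mem _ (mk_mem_maximalIdeal_iff.mp hx)

lemma IsSocleGenerator.quotient {I : Ideal R} {σ : R} (h : IsSocleGenerator I σ)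
    [IsLocalRing (R ⧸ I)] : IsSocleGenerator (⊥ : Ideal (R ⧸ I)) (Ideal.Quotient.mk I σ) := by
  refine ⟨fun h0 => h.notMem (Ideal.Quotient.eq_zero_iff_mem.mp h0), fun x hx => ?_,
    fun y hy => ?_⟩
  · obtain ⟨x, rfl⟩ := Ideal.Quotient.mk_surjective x
    exact Ideal.Quotient.eq_zero_iff_mem.mpr (h.mul_mem x (mk_mem_maximalIdeal_iff.mp hx))
  · obtain ⟨y, rfl⟩ := Ideal.Quotient.mk_surjective y
    obtain ⟨c, hc⟩ := h.exists_sub_mem y fun x hx =>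
      Ideal.Quotient.eq_zero_iff_mem.mp (hy _ (mk_mem_maximalIdeal_iff.mpr hx))
    exact ⟨Ideal.Quotient.mk I c, Ideal.Quotient.eq_zero_iff_mem.mpr hc⟩

end Socle

section SelfInjective

variable {R : Type u} [CommRing R] [IsLocalRing R]

/-- Every homomorphism from `J` to `R` is a multiplication, and `J` is its own double
annihilator. -/
structure IsAnnihilatorDual (J : Ideal R) : Prop where
  exists_mul : ∀ f : J →ₗ[R] R, ∃ c, ∀ x : J, f x = c * x
  mem : ∀ y, (∀ t, (∀ x ∈ J, t * x = 0) → t * y = 0) → y ∈ J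

lemma IsAnnihilatorDual.sup_span {σ : R} (hσ : IsSocleGenerator ⊥ σ) {I : Ideal R}
    (hI : IsAnnihilatorDual I) {x : R} (hxI : x ∉ I) (hx : ∀ z ∈ maximalIdeal R, z * x ∈ I) :
    IsAnnihilatorDual (I ⊔ Ideal.span {x}) := by
  have hxJ : x ∈ I ⊔ Ideal.span {x} := Ideal.mem_sup_right (Ideal.mem_span_singleton_self x)
  have hIJ : I ≤ I ⊔ Ideal.span {x} := le_sup_left
  have hsoc : ∀ t, (∀ i ∈ I, t * i = 0) → ∃ c, t * x = c * σ := by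
    intro t ht
    obtain ⟨c, hc⟩ := hσ.exists_sub_mem (t * x) fun z hz => by
      rw [Ideal.mem_bot, mul_left_comm]
      exact ht _ (hx z hz)
    exact ⟨c, sub_eq_zero.mp hc⟩
  obtain ⟨t0, ht0, ht0x⟩ : ∃ t0, (∀ i ∈ I, t0 * i = 0) ∧ t0 * x = σ := by
    have := mt (hI.mem x) hxI
    push Not at this
    obtain ⟨t, ht, htx⟩ := this
    obtain ⟨c, hc⟩ := hsoc t ht
    obtain ⟨u, rfl⟩ := hσ.isUnit_of_mul_notMem (c := c) (by
      rw [Ideal.mem_bot, ← hc]; exact htx)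
    refine ⟨↑u⁻¹ * t, fun i hi => by rw [mul_assoc, ht i hi, mul_zero], ?_⟩
    rw [mul_assoc, hc, ← mul_assoc, u.inv_mul, one_mul]
  have hkill : ∀ t, (∀ i ∈ I, t * i = 0) → t * x = 0 → ∀ y ∈ I ⊔ Ideal.span {x}, t * y = 0 := by
    intro t ht htx y hy
    obtain ⟨i, hi, z, hz, rfl⟩ := Submodule.mem_sup.mp hy
    obtain ⟨c, rfl⟩ := Ideal.mem_span_singleton'.mp hz
    rw [mul_add, ht i hi, mul_left_comm, htx, mul_zero, add_zero]
  constructor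
  · intro f
    obtain ⟨c, hc⟩ := hI.exists_mul (f ∘ₗ Submodule.inclusion hIJ)
    have hc' : ∀ i (hi : i ∈ I), f ⟨i, hIJ hi⟩ = c * i := fun i hi => hc ⟨i, hi⟩
    obtain ⟨d, hd⟩ := hσ.exists_sub_mem (f ⟨x, hxJ⟩ - c * x) fun z hz => by
      have h1 := hc' _ (hx z hz)
      have h2 : (⟨z * x, hIJ (hx z hz)⟩ : (I ⊔ Ideal.span {x} : Ideal R)) = z • ⟨x, hxJ⟩ := rfl
      rw [h2, map_smul, smul_eq_mul] at h1
      rw [Ideal.mem_bot, mul_sub, h1]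
      ring
    have hd : f ⟨x, hxJ⟩ = (c + d * t0) * x := by
      rw [Ideal.mem_bot] at hd
      linear_combination hd - d * ht0x
    refine ⟨c + d * t0, fun ⟨y, hy⟩ => ?_⟩
    obtain ⟨i, hi, z, hz, rfl⟩ := Submodule.mem_sup.mp hy
    obtain ⟨e, rfl⟩ := Ideal.mem_span_singleton'.mp hz
    have h2 : (⟨i + e * x, hy⟩ : (I ⊔ Ideal.span {x} : Ideal R)) =
      ⟨i, hIJ hi⟩ + e • ⟨x, hxJ⟩ := rfl
    rw [h2, map_add, map_smul, smul_eq_mul, hd, hc' i hi]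
    change _ = _ * (i + e * x)
    linear_combination (-d) * ht0 i hi
  · intro y hy
    obtain ⟨c, hc⟩ := hσ.exists_sub_mem (t0 * y) fun z hz => by
      rw [Ideal.mem_bot, ← mul_assoc]
      refine hy _ (hkill _ (fun i hi => by rw [mul_assoc, ht0 i hi, mul_zero]) ?_)
      rw [mul_assoc, ht0x]
      exact hσ.mul_mem z hz
    rw [Ideal.mem_bot, sub_eq_zero] at hc
    have hmem : y - c * x ∈ I := by
      refine hI.mem _ fun t ht => ?_
      obtain ⟨e, he⟩ := hsoc t ht
      have h1 := hy (t - e * t0) (hkill _ (fun i hi => by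
        rw [sub_mul, ht i hi, mul_assoc, ht0 i hi]; ring) (by
        rw [sub_mul, he, mul_assoc, ht0x, sub_self]))
      linear_combination h1 + e * hc - c * he
    have : y = (y - c * x) + c * x := by ring
    rw [this]
    exact add_mem (hIJ hmem) (Ideal.mul_mem_left _ c hxJ)

lemma isAnnihilatorDual_of_isSocleGenerator [IsNoetherianRing R] {σ : R}
    (hσ : IsSocleGenerator ⊥ σ) {k : ℕ} (hk : maximalIdeal R ^ k = ⊥) (J : Ideal R) :
    IsAnnihilatorDual J := by
  have hbot : IsAnnihilatorDual (⊥ : Ideal R) := by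
    refine ⟨fun f => ⟨0, fun x => ?_⟩, fun y hy => ?_⟩
    · rw [Subsingleton.elim x 0]; simp
    · simpa using hy 1 (by simp)
  obtain ⟨I, ⟨hIJ, hI⟩, hmax⟩ := set_has_maximal_iff_noetherian.mpr
    (inferInstance : IsNoetherian R R) {I : Ideal R | I ≤ J ∧ IsAnnihilatorDual I}
    ⟨⊥, bot_le, hbot⟩
  rcases eq_or_lt_of_le hIJ with rfl | hlt
  · exact hI
  obtain ⟨a, haJ, haI⟩ := SetLike.exists_of_lt hlt
  obtain ⟨r, hr, hmr⟩ := exists_mul_notMem_of_pow_le (hk.trans_le bot_le) haI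
  refine absurd ?_ (hmax (I ⊔ Ideal.span {r * a}) ⟨?_, hI.sup_span hσ hr hmr⟩)
  · refine lt_of_le_of_ne le_sup_left fun h => hr ?_
    rw [h]
    exact Ideal.mem_sup_right (Ideal.mem_span_singleton_self _)
  · exact sup_le hIJ ((Ideal.span_singleton_le_iff_mem _).mpr (J.mul_mem_left r haJ))

lemma injective_of_isSocleGenerator [IsNoetherianRing R] {σ : R}
    (hσ : IsSocleGenerator ⊥ σ) {k : ℕ} (hk : maximalIdeal R ^ k = ⊥) : Module.Injective R R := by
  refine Module.Baer.injective fun I g => ?_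
  obtain ⟨c, hc⟩ := (isAnnihilatorDual_of_isSocleGenerator hσ hk I).exists_mul g
  exact ⟨LinearMap.lsmul R R c, fun x hx => (hc ⟨x, hx⟩).symm⟩

end SelfInjective

lemma exists_eq_mul_of_injective {R : Type u} [CommRing R] [Module.Injective R R] {a b : R}
    (h : ∀ r, a * r = 0 → b * r = 0) : ∃ c, b = c * a := by
  let K := LinearMap.ker (LinearMap.lsmul R R a)
  obtain ⟨φ, hφ⟩ := Module.Injective.out (Q := R) (K.liftQ (LinearMap.lsmul R R a) le_rfl)
    (LinearMap.ker_eq_bot.mp (Submodule.ker_liftQ_eq_bot _ _ _ le_rfl))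
    (K.liftQ (LinearMap.lsmul R R b) fun r hr => h r hr)
  have : φ (a * 1) = b * 1 := hφ (Submodule.Quotient.mk 1)
  rw [mul_one, mul_one] at this
  refine ⟨φ 1, ?_⟩
  rw [← this, mul_comm, ← smul_eq_mul a, ← map_smul, smul_eq_mul, mul_one]

section

variable {R : Type u} [CommRing R] [IsLocalRing R]

lemma isNilpotent_of_injective [IsNoetherianRing R] [Module.Injective R R] {x : R}
    (hx : x ∈ maximalIdeal R) : IsNilpotent x := by
  obtain ⟨n, hn⟩ := monotone_stabilizes_iff_noetherian.mpr (inferInstance : IsNoetherian R R)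
    ⟨fun n => LinearMap.ker (LinearMap.lsmul R R (x ^ n)),
      monotone_nat_of_le_succ fun n r hr => by
        simp only [LinearMap.mem_ker, LinearMap.lsmul_apply, smul_eq_mul] at hr ⊢
        rw [pow_succ', mul_assoc, hr, mul_zero]⟩
  obtain ⟨c, hc⟩ := exists_eq_mul_of_injective (a := x ^ (n + 1)) (b := x ^ n) fun r hr => by
    have : r ∈ LinearMap.ker (LinearMap.lsmul R R (x ^ (n + 1))) := hr
    rw [← show LinearMap.ker (LinearMap.lsmul R R (x ^ n)) =
      LinearMap.ker (LinearMap.lsmul R R (x ^ (n + 1))) from hn (n + 1) (by lia)] at this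
    exact this
  refine ⟨n, ?_⟩
  have hu : IsUnit (1 - c * x) := by
    by_contra h
    have h1 := (mem_maximalIdeal (1 - c * x)).mpr h
    have := (maximalIdeal R).add_mem h1 ((maximalIdeal R).mul_mem_left c hx)
    rw [sub_add_cancel] at this
    exact (Ideal.ne_top_iff_one _).mp (maximalIdeal.isMaximal R).ne_top this
  refine hu.mul_right_eq_zero.mp ?_
  linear_combination hc

lemma isSocleGenerator_of_injective [Module.Injective R R] {σ : R} (hσ : σ ≠ 0)
    (hmσ : ∀ x ∈ maximalIdeal R, x * σ = 0) : IsSocleGenerator (⊥ : Ideal R) σ := by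
  refine ⟨hσ, hmσ, fun y hy => ?_⟩
  obtain ⟨c, hc⟩ := exists_eq_mul_of_injective (a := σ) (b := y) fun r hr => by
    rw [mul_comm]
    refine hy r ((mem_maximalIdeal r).mpr fun hu => hσ ?_)
    exact (hu.mul_left_eq_zero).mp hr
  exact ⟨c, by rw [Ideal.mem_bot, hc, sub_self]⟩

lemma injective_of_residueExtVanishes [IsNoetherianRing R] (h : ResidueExtVanishes R) {σ : R}
    (hσ : σ ≠ 0) (hmσ : ∀ x ∈ maximalIdeal R, x * σ = 0) : Module.Injective R R := by
  obtain ⟨n, hn⟩ := h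
  have key : ∀ n, (∀ i ≥ n + 1, ExtVanishes R (ResidueField R) R i) →
      ∀ i ≥ 1, ExtVanishes R (ResidueField R) R i := by
    intro n
    induction n with
    | zero => exact id
    | succ n ih =>
      intro hn
      refine ih fun i hi => ?_
      let f : (R ⧸ maximalIdeal R) →ₗ[R] R :=
        Submodule.liftQ _ (LinearMap.toSpanSingleton R R σ) fun x hx => hmσ x hx
      have hf : Function.Injective f := by
        refine LinearMap.ker_eq_bot.mp (Submodule.ker_liftQ_eq_bot _ _ _ fun r hr => ?_)
        refine (mem_maximalIdeal r).mpr fun hu => hσ ?_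
        exact hu.mul_right_eq_zero.mp hr
      have hex : Function.Exact f (Submodule.mkQ (Ideal.span {σ})) := by
        intro y
        rw [Submodule.mkQ_apply, Submodule.Quotient.mk_eq_zero]
        constructor
        · intro hy
          obtain ⟨c, rfl⟩ := Ideal.mem_span_singleton'.mp hy
          exact ⟨Submodule.Quotient.mk c, rfl⟩
        · rintro ⟨c, rfl⟩
          obtain ⟨c, rfl⟩ := Submodule.Quotient.mk_surjective _ c
          exact Ideal.mem_span_singleton'.mpr ⟨c, rfl⟩
      obtain ⟨i, rfl⟩ := Nat.exists_eq_succ_of_ne_zero (by lia : i ≠ 0)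
      exact ExtVanishes.left hf hex (Submodule.mkQ_surjective _) (ExtVanishes.of_self_left i)
        (extVanishes_quotient_of_residueField hn _ _ (by lia))
  exact injective_of_extVanishes_one fun I => extVanishes_quotient_of_residueField
    (key n fun i hi => hn i (by lia)) I 1 le_rfl

end


section ChangeOfRings

variable {R : Type u} [CommRing R] {x : R}

/-- `ι` identifies `T` with the submodule of elements of `D` killed by `x`. -/
structure IsTorsionPart {T D : Type u} [AddCommGroup T] [Module R T] [AddCommGroup D] [Module R D]
    (x : R) (ι : T →ₗ[R] D) : Prop where
  injective : Function.Injective ι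
  smul_eq_zero : ∀ t, x • ι t = 0
  exists_eq : ∀ d, x • d = 0 → ∃ t, ι t = d

lemma smul_eq_zero_of_quotient {N : Type u} [AddCommGroup N] [Module R N]
    [Module (R ⧸ Ideal.span {x}) N] [IsScalarTower R (R ⧸ Ideal.span {x}) N] (n : N) :
    x • n = 0 := by
  rw [← one_smul (R ⧸ Ideal.span {x}) n, ← smul_assoc]
  have : x • (1 : R ⧸ Ideal.span {x}) = 0 := by
    change Ideal.Quotient.mk _ (x • 1) = 0
    rw [Ideal.Quotient.eq_zero_iff_mem, smul_eq_mul, mul_one]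
    exact Ideal.mem_span_singleton_self x
  rw [this, zero_smul]

lemma exists_isTorsionPart (x : R) (D : Type u) [AddCommGroup D] [Module R D] :
    ∃ (T : ModuleCat.{u} (R ⧸ Ideal.span {x})) (_ : Module R T)
      (_ : IsScalarTower R (R ⧸ Ideal.span {x}) T) (ι : T →ₗ[R] D), IsTorsionPart x ι := by
  refine ⟨ModuleCat.of (R ⧸ Ideal.span {x}) (Submodule.torsionBy R D x),
    inferInstanceAs (Module R (Submodule.torsionBy R D x)),
    inferInstanceAs (IsScalarTower R (R ⧸ Ideal.span {x}) (Submodule.torsionBy R D x)),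
    (Submodule.torsionBy R D x).subtype, Submodule.subtype_injective _, fun t => t.2,
    fun d hd => ⟨⟨d, hd⟩, rfl⟩⟩

section

variable {D T N : Type u} [AddCommGroup D] [Module R D]
  [AddCommGroup T] [Module R T] [Module (R ⧸ Ideal.span {x}) T]
  [IsScalarTower R (R ⧸ Ideal.span {x}) T]
  [AddCommGroup N] [Module R N] [Module (R ⧸ Ideal.span {x}) N]
  [IsScalarTower R (R ⧸ Ideal.span {x}) N]

lemma IsTorsionPart.exists_lift {ι : T →ₗ[R] D} (hι : IsTorsionPart x ι) (φ : N →ₗ[R] D) :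
    ∃ ψ : N →ₗ[R ⧸ Ideal.span {x}] T, ∀ n, ι (ψ n) = φ n := by
  have h : ∀ n, ∃ t, ι t = φ n := fun n => hι.exists_eq _ (by
    rw [← map_smul, smul_eq_zero_of_quotient, map_zero])
  choose ψ hψ using h
  refine ⟨{ toFun := ψ, map_add' := fun a b => hι.injective ?_,
            map_smul' := fun r a => hι.injective ?_ }, hψ⟩
  · rw [map_add, hψ, hψ, hψ, map_add]
  · obtain ⟨r, rfl⟩ := Ideal.Quotient.mk_surjective r
    rw [hψ]
    have h1 : ∀ a : N, Ideal.Quotient.mk (Ideal.span {x}) r • a = r • a := fun a => by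
      rw [← algebraMap_smul (R ⧸ Ideal.span {x}) r a]; rfl
    have h2 : ∀ a : T, Ideal.Quotient.mk (Ideal.span {x}) r • a = r • a := fun a => by
      rw [← algebraMap_smul (R ⧸ Ideal.span {x}) r a]; rfl
    rw [h1, RingHom.id_apply, h2, map_smul, map_smul, hψ]

lemma IsTorsionPart.module_injective {ι : T →ₗ[R] D} (hι : IsTorsionPart x ι)
    [Module.Injective R D] : Module.Injective (R ⧸ Ideal.span {x}) T := by
  refine Module.Baer.injective fun I g => ?_
  obtain ⟨h, hh⟩ := Module.Injective.out (Q := D) (I.subtype.restrictScalars R)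
    (Submodule.subtype_injective I) (ι ∘ₗ g.restrictScalars R)
  obtain ⟨ψ, hψ⟩ := hι.exists_lift h
  exact ⟨ψ, fun a ha => hι.injective ((hψ a).trans (hh ⟨a, ha⟩))⟩

lemma exists_smul_eq_of_injective (hx : x ∈ nonZeroDivisors R) [Module.Injective R D] (d : D) :
    ∃ d', x • d' = d := by
  obtain ⟨h, hh⟩ := Module.Injective.out (Q := D) (LinearMap.lsmul R R x)
    (fun a b hab => (mul_cancel_left_mem_nonZeroDivisors hx).mp hab) (LinearMap.toSpanSingleton R D d)
  refine ⟨h 1, ?_⟩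
  have := hh 1
  simp only [LinearMap.lsmul_apply, map_smul, LinearMap.toSpanSingleton_apply, one_smul] at this
  exact this

lemma extVanishes_iff_of_isTorsionPart (hx : x ∈ nonZeroDivisors R) (i : ℕ)
    {D T : Type u} [AddCommGroup D] [Module R D]
    [AddCommGroup T] [Module R T] [Module (R ⧸ Ideal.span {x}) T]
    [IsScalarTower R (R ⧸ Ideal.span {x}) T] {ι : T →ₗ[R] D} (hι : IsTorsionPart x ι)
    (hD : ∀ d : D, ∃ d', x • d' = d) :
    ExtVanishes R N D (i + 1) ↔ ExtVanishes (R ⧸ Ideal.span {x}) N T (i + 1) := by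
  induction i using Nat.strong_induction_on generalizing D T with | _ i ih =>
  obtain ⟨E, f, hE, hf⟩ := exists_injective_embedding R D
  have hdivE := exists_smul_eq_of_injective (D := E) hx
  let C := E ⧸ LinearMap.range f
  let g : E →ₗ[R] C := (LinearMap.range f).mkQ
  have hg : Function.Surjective g := Submodule.mkQ_surjective _
  have hfg : Function.Exact f g := LinearMap.exact_map_mkQ_range f
  obtain ⟨TE, _, _, ιE, hιE⟩ := exists_isTorsionPart x E
  obtain ⟨TC, _, _, ιC, hιC⟩ := exists_isTorsionPart x C
  obtain ⟨Tf, hTf⟩ := hιE.exists_lift (f ∘ₗ ι)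
  obtain ⟨Tg, hTg⟩ := hιC.exists_lift (g ∘ₗ ιE)
  have hTfinj : Function.Injective Tf := fun a b hab => by
    have := congrArg ιE hab
    rw [hTf, hTf] at this
    exact hι.injective (hf this)
  have hTgsurj : Function.Surjective Tg := fun c => by
    obtain ⟨e, he⟩ := hg (ιC c)
    have h1 : g (x • e) = 0 := by rw [map_smul, he, hιC.smul_eq_zero]
    obtain ⟨d, hd⟩ := (hfg _).mp h1
    obtain ⟨d', rfl⟩ := hD d
    obtain ⟨t, ht⟩ := hιE.exists_eq (e - f d') (by rw [smul_sub, ← map_smul, hd, sub_self])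
    refine ⟨t, hιC.injective ?_⟩
    rw [hTg, LinearMap.comp_apply, ht, map_sub, he, hfg.apply_apply_eq_zero, sub_zero]
  have hTex : Function.Exact Tf Tg := fun t => by
    rw [← hιC.injective.eq_iff, hTg, map_zero, LinearMap.comp_apply, hfg]
    constructor
    · rintro ⟨d, hd⟩
      obtain ⟨s, rfl⟩ := hι.exists_eq d (hf (by
        rw [map_smul, hd, hιE.smul_eq_zero, map_zero]))
      exact ⟨s, hιE.injective ((hTf s).trans hd)⟩
    · rintro ⟨s, rfl⟩
      exact ⟨ι s, (hTf s).symm⟩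
  have hTE := hιE.module_injective
  have hdivC : ∀ c : C, ∃ c', x • c' = c := fun c => by
    obtain ⟨e, rfl⟩ := hg c
    obtain ⟨e', rfl⟩ := hdivE e
    exact ⟨g e', (map_smul _ _ _).symm⟩
  cases i with
  | zero =>
    rw [extVanishes_one_iff_of_injective_middle hf hfg hg,
      extVanishes_one_iff_of_injective_middle hTfinj hTex hTgsurj]
    constructor
    · intro h φ
      obtain ⟨ψ, hψ⟩ := h (ιC ∘ₗ φ.restrictScalars R)
      obtain ⟨χ, hχ⟩ := hιE.exists_lift ψ
      refine ⟨χ, LinearMap.ext fun n => hιC.injective ?_⟩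
      rw [LinearMap.comp_apply, hTg, LinearMap.comp_apply, hχ]
      exact LinearMap.congr_fun hψ n
    · intro h φ
      obtain ⟨φ', hφ'⟩ := hιC.exists_lift φ
      obtain ⟨ψ, hψ⟩ := h φ'
      refine ⟨ιE ∘ₗ ψ.restrictScalars R, LinearMap.ext fun n => ?_⟩
      rw [← hφ', ← hψ]
      exact (hTg (ψ n)).symm
  | succ i =>
    rw [← extVanishes_succ_iff_of_injective_middle hf hfg hg,
      ← extVanishes_succ_iff_of_injective_middle hTfinj hTex hTgsurj]
    exact ih i (Nat.lt_succ_self i) hιC hdivC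

lemma extVanishes_iff_quotient (hx : x ∈ nonZeroDivisors R) (i : ℕ) :
    ExtVanishes R N R (i + 2) ↔
      ExtVanishes (R ⧸ Ideal.span {x}) N (R ⧸ Ideal.span {x}) (i + 1) := by
  obtain ⟨E, f, hE, hf⟩ := exists_injective_embedding R R
  have hdivE := exists_smul_eq_of_injective (D := E) hx
  let C := E ⧸ LinearMap.range f
  let g : E →ₗ[R] C := (LinearMap.range f).mkQ
  have hg : Function.Surjective g := Submodule.mkQ_surjective _
  have hfg : Function.Exact f g := LinearMap.exact_map_mkQ_range f
  have hdivC : ∀ c : C, ∃ c', x • c' = c := fun c => by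
    obtain ⟨e, rfl⟩ := hg c
    obtain ⟨e', rfl⟩ := hdivE e
    exact ⟨g e', (map_smul _ _ _).symm⟩
  obtain ⟨TE, _, _, ιE, hιE⟩ := exists_isTorsionPart x E
  obtain ⟨TC, _, _, ιC, hιC⟩ := exists_isTorsionPart x C
  obtain ⟨Tg, hTg⟩ := hιC.exists_lift (g ∘ₗ ιE)
  have hreg : ∀ r : R, x * r = 0 → r = 0 := fun r hr => (mem_nonZeroDivisors_iff.mp hx).1 r hr
  have hTginj : Function.Injective Tg := by
    refine (injective_iff_map_eq_zero Tg).mpr fun t ht => ?_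
    have h1 : g (ιE t) = 0 := by
      rw [← LinearMap.comp_apply, ← hTg, ht, map_zero]
    obtain ⟨r, hr⟩ := (hfg _).mp h1
    have h2 : x * r = 0 := hf (by
      rw [← smul_eq_mul, map_smul, hr, hιE.smul_eq_zero, map_zero])
    rw [hreg r h2, map_zero] at hr
    exact hιE.injective (hr.symm.trans (map_zero ιE).symm)
  have hex : ∀ c : TC, ∃ r : R, ∃ e : E, g e = ιC c ∧ x • e = f r := fun c => by
    obtain ⟨e, he⟩ := hg (ιC c)
    have h1 : g (x • e) = 0 := by rw [map_smul, he, hιC.smul_eq_zero]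
    obtain ⟨d, hd⟩ := (hfg _).mp h1
    exact ⟨d, e, he, hd.symm⟩
  have huniq : ∀ (r r' : R) (e e' : E), g e = g e' → x • e = f r → x • e' = f r' →
      Ideal.Quotient.mk (Ideal.span {x}) r = Ideal.Quotient.mk (Ideal.span {x}) r' := by
    intro r r' e e' hee he he'
    obtain ⟨s, hs⟩ := (hfg (e - e')).mp (by rw [map_sub, hee, sub_self])
    rw [Ideal.Quotient.eq, Ideal.mem_span_singleton']
    refine ⟨s, hf ?_⟩
    rw [mul_comm, ← smul_eq_mul, map_smul, hs, smul_sub, he, he', map_sub]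
  choose ρ ε hε hρ using hex
  let δ' : TC →ₗ[R] (R ⧸ Ideal.span {x}) :=
    { toFun := fun c => Ideal.Quotient.mk _ (ρ c)
      map_add' := fun c c' => by
        rw [← map_add]
        refine huniq _ _ (ε (c + c')) (ε c + ε c') ?_ (hρ _) ?_
        · rw [map_add, hε, hε, hε, map_add]
        · rw [smul_add, hρ, hρ, map_add]
      map_smul' := fun r c => by
        change _ = Ideal.Quotient.mk _ (r * ρ c)
        refine huniq _ _ (ε (r • c)) (r • ε c) ?_ (hρ _) ?_
        · rw [map_smul, hε, hε, map_smul]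
        · rw [smul_comm, hρ, ← smul_eq_mul, map_smul] }
  obtain ⟨δ, hδ⟩ : ∃ δ : TC →ₗ[R ⧸ Ideal.span {x}] (R ⧸ Ideal.span {x}), ∀ c, δ c = δ' c :=
    ⟨LinearMap.extendScalarsOfSurjective Ideal.Quotient.mk_surjective δ', fun _ => rfl⟩
  have hδ : ∀ c, δ c = Ideal.Quotient.mk _ (ρ c) := hδ
  have hδsurj : Function.Surjective δ := fun a => by
    obtain ⟨r, rfl⟩ := Ideal.Quotient.mk_surjective a
    obtain ⟨e, he⟩ := hdivE (f r)
    obtain ⟨c, hc⟩ := hιC.exists_eq (g e) (by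
      rw [← map_smul, he, hfg.apply_apply_eq_zero])
    exact ⟨c, (hδ c).trans (huniq _ _ (ε c) e ((hε c).trans hc) (hρ c) he)⟩
  have hδex : Function.Exact Tg δ := fun c => by
    rw [hδ, Ideal.Quotient.eq_zero_iff_mem, Ideal.mem_span_singleton']
    constructor
    · rintro ⟨s, hs⟩
      obtain ⟨t, ht⟩ := hιE.exists_eq (ε c - f s) (by
        rw [smul_sub, hρ, ← hs, ← map_smul, smul_eq_mul, mul_comm, sub_self])
      refine ⟨t, hιC.injective ?_⟩
      rw [hTg, LinearMap.comp_apply, ht, map_sub, hε, hfg.apply_apply_eq_zero, sub_zero]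
    · rintro ⟨t, rfl⟩
      rw [← Ideal.mem_span_singleton', ← Ideal.Quotient.eq_zero_iff_mem,
        ← map_zero (Ideal.Quotient.mk (Ideal.span {x}))]
      refine huniq _ _ (ε (Tg t)) (ιE t) ?_ (hρ _) ?_
      · rw [hε, hTg]; rfl
      · rw [hιE.smul_eq_zero, map_zero]
  have hTE := hιE.module_injective
  rw [← extVanishes_succ_iff_of_injective_middle hf hfg hg,
    extVanishes_iff_of_isTorsionPart hx i hιC hdivC]
  exact extVanishes_iff_of_injective_left hTginj hδex hδsurj i

end

lemma residueExtVanishes_quotient_iff [IsLocalRing R] [IsLocalRing (R ⧸ Ideal.span {x})]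
    (hx : x ∈ nonZeroDivisors R) :
    ResidueExtVanishes (R ⧸ Ideal.span {x}) ↔ ResidueExtVanishes R := by
  let A := R ⧸ Ideal.span {x}
  let g : R →ₗ[R] ResidueField A :=
    { toFun := fun r => residue A (Ideal.Quotient.mk _ r)
      map_add' := fun a b => by simp
      map_smul' := fun a b => by
        rw [smul_eq_mul, map_mul, map_mul, Algebra.smul_def]; rfl }
  have hgs : Function.Surjective g := fun a => by
    obtain ⟨a, rfl⟩ := residue_surjective a
    obtain ⟨a, rfl⟩ := Ideal.Quotient.mk_surjective a
    exact ⟨a, rfl⟩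
  have hker : maximalIdeal R = LinearMap.ker g := by
    ext r
    rw [LinearMap.mem_ker]
    change _ ↔ residue A (Ideal.Quotient.mk _ r) = 0
    rw [residue_eq_zero_iff]
    exact mk_mem_maximalIdeal_iff.symm
  let e : ResidueField R ≃ₗ[R] ResidueField A :=
    (Submodule.quotEquivOfEq _ _ hker).trans (g.quotKerEquivOfSurjective hgs)
  have key : ∀ i, ExtVanishes R (ResidueField R) R (i + 2) ↔
      ExtVanishes A (ResidueField A) A (i + 1) := fun i => by
    rw [← extVanishes_iff_quotient hx]
    exact ⟨fun h => h.congr_left e, fun h => h.congr_left e.symm⟩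
  constructor
  · rintro ⟨n, hn⟩
    refine ⟨n + 2, fun i hi => ?_⟩
    obtain ⟨i, rfl⟩ := Nat.exists_eq_add_of_le' (by lia : 2 ≤ i)
    exact (key i).mpr (hn _ (by lia))
  · rintro ⟨n, hn⟩
    refine ⟨n + 1, fun i hi => ?_⟩
    obtain ⟨i, rfl⟩ := Nat.exists_eq_add_of_le' (by lia : 1 ≤ i)
    exact (key i).mp (hn _ (by lia))

end ChangeOfRings

section ParamSystem

lemma isPrincipal_top_hom_quotient_iff {R : Type*} [CommRing R] {I J : Ideal R} :
    Submodule.IsPrincipal (⊤ : Submodule R ((R ⧸ I) →ₗ[R] (R ⧸ J))) ↔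
      ∃ s : R, (∀ y ∈ I, s * y ∈ J) ∧
        ∀ t : R, (∀ y ∈ I, t * y ∈ J) → ∃ c, t - c * s ∈ J := by
  have mul_mem_of_hom : ∀ (f : (R ⧸ I) →ₗ[R] (R ⧸ J)) (t : R),
      f 1 = Ideal.Quotient.mk J t → ∀ y ∈ I, t * y ∈ J := by
    intro f t ht y hy
    rw [← Ideal.Quotient.eq_zero_iff_mem, mul_comm, map_mul, ← ht, ← smul_eq_mul]
    change y • f 1 = 0
    rw [← map_smul]
    have : y • (1 : R ⧸ I) = 0 := by
      rw [Algebra.smul_def, mul_one]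
      exact Ideal.Quotient.eq_zero_iff_mem.mpr hy
    rw [this, map_zero]
  have exists_hom : ∀ t : R, (∀ y ∈ I, t * y ∈ J) →
      ∃ f : (R ⧸ I) →ₗ[R] (R ⧸ J), f 1 = Ideal.Quotient.mk J t := by
    intro t ht
    refine ⟨I.liftQ (LinearMap.toSpanSingleton R _ (Ideal.Quotient.mk J t)) fun y hy => ?_, ?_⟩
    · rw [LinearMap.mem_ker, LinearMap.toSpanSingleton_apply, Algebra.smul_def]
      change Ideal.Quotient.mk J y * Ideal.Quotient.mk J t = 0
      rw [← map_mul, mul_comm]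
      exact Ideal.Quotient.eq_zero_iff_mem.mpr (ht y hy)
    · change LinearMap.toSpanSingleton R _ (Ideal.Quotient.mk J t) 1 = _
      rw [LinearMap.toSpanSingleton_apply, one_smul]
  have smul_mk : ∀ c s : R, c • Ideal.Quotient.mk J s = Ideal.Quotient.mk J (c * s) :=
    fun c s => by rw [Algebra.smul_def, map_mul]; rfl
  constructor
  · rintro ⟨f, hf⟩
    obtain ⟨s, hs⟩ := Ideal.Quotient.mk_surjective (f 1)
    refine ⟨s, mul_mem_of_hom f s hs.symm, fun t ht => ?_⟩
    obtain ⟨g, hg⟩ := exists_hom t ht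
    obtain ⟨c, rfl⟩ := Submodule.mem_span_singleton.mp (hf ▸ Submodule.mem_top (x := g))
    refine ⟨c, Ideal.Quotient.eq.mp ?_⟩
    rw [← hg, LinearMap.smul_apply, ← hs, smul_mk]
  · rintro ⟨s, hs, hs'⟩
    obtain ⟨f, hf⟩ := exists_hom s hs
    refine ⟨f, (eq_top_iff.mpr fun g _ => ?_).symm⟩
    obtain ⟨t, ht⟩ := Ideal.Quotient.mk_surjective (g 1)
    obtain ⟨c, hc⟩ := hs' t (mul_mem_of_hom g t ht.symm)
    refine Submodule.mem_span_singleton.mpr ⟨c, LinearMap.ext fun z => ?_⟩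
    obtain ⟨z, rfl⟩ := Ideal.Quotient.mk_surjective z
    have hz : Ideal.Quotient.mk I z = z • (1 : R ⧸ I) := by
      rw [Algebra.smul_def, mul_one]; rfl
    rw [hz, map_smul, map_smul, LinearMap.smul_apply, hf, ← ht, smul_mk,
      Ideal.Quotient.eq.mpr hc]

lemma isIrreducibleIdeal_comap_mk_iff {R : Type*} [CommRing R] {K : Ideal R} {I : Ideal (R ⧸ K)} :
    IsIrreducibleIdeal (I.comap (Ideal.Quotient.mk K)) ↔ IsIrreducibleIdeal I := by
  have hsurj : Function.Surjective (Ideal.Quotient.mk K) := Ideal.Quotient.mk_surjective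
  have hinj := Ideal.comap_injective_of_surjective _ hsurj
  have htop : I.comap (Ideal.Quotient.mk K) = ⊤ ↔ I = ⊤ := Ideal.comap_eq_top_iff
  refine and_congr htop.not ⟨fun h J L hJL => ?_, fun h J L hJL => ?_⟩
  · exact (h (J.comap _) (L.comap _) (by rw [hJL, Ideal.comap_inf])).imp (hinj ·) (hinj ·)
  · have hK : K ≤ I.comap (Ideal.Quotient.mk K) := fun x hx => by
      rw [Ideal.mem_comap, Ideal.Quotient.eq_zero_iff_mem.mpr hx]
      exact I.zero_mem
    have comap_map : ∀ J : Ideal R, K ≤ J →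
        (J.map (Ideal.Quotient.mk K)).comap (Ideal.Quotient.mk K) = J := fun J hJ => by
      rw [Ideal.comap_map_of_surjective' _ hsurj, Ideal.mk_ker, sup_eq_left.mpr hJ]
    have hJ := comap_map J (hK.trans (hJL ▸ inf_le_left))
    have hL := comap_map L (hK.trans (hJL ▸ inf_le_right))
    refine (h (J.map (Ideal.Quotient.mk K)) (L.map (Ideal.Quotient.mk K))
      (hinj ?_)).imp (fun h => ?_) fun h => ?_
    · rw [Ideal.comap_inf, hJ, hL, hJL]
    · rw [h, hJ]
    · rw [h, hL]

lemma span_range_cons {R : Type*} [CommRing R] {n : ℕ} (x : R) (b : Fin n → R) :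
    Ideal.span (Set.range (Fin.cons x b : Fin (n + 1) → R)) =
      Ideal.span {x} ⊔ Ideal.span (Set.range b) := by
  rw [Fin.range_cons, Ideal.span_insert]

variable {R : Type u} [CommRing R] [IsLocalRing R]

/-- The family `a` is a system of parameters of the local ring `R`. -/
structure IsParamSystem {d : ℕ} (a : Fin d → R) : Prop where
  dim_eq : ringKrullDim R = d
  mem : ∀ i, a i ∈ maximalIdeal R
  le_radical : maximalIdeal R ≤ (Ideal.span (Set.range a)).radical

lemma IsParamSystem.span_le {d : ℕ} {a : Fin d → R} (h : IsParamSystem a) :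
    Ideal.span (Set.range a) ≤ maximalIdeal R :=
  Ideal.span_le.mpr (Set.range_subset_iff.mpr h.mem)

lemma isParameterIdeal_iff {I : Ideal R} :
    IsParameterIdeal R I ↔
      ∃ (d : ℕ) (a : Fin d → R), IsParamSystem a ∧ I = Ideal.span (Set.range a) := by
  constructor
  · rintro ⟨d, a, hd, ha, rfl, hrad⟩
    exact ⟨d, a, ⟨hd, ha, hrad.ge⟩, rfl⟩
  · rintro ⟨d, a, h, rfl⟩
    refine ⟨d, a, h.dim_eq, h.mem, rfl, le_antisymm ?_ h.le_radical⟩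
    exact (Ideal.radical_mono h.span_le).trans
      (maximalIdeal.isMaximal R).isPrime.radical.le

lemma IsParamSystem.isParameterIdeal {d : ℕ} {a : Fin d → R} (h : IsParamSystem a) :
    IsParameterIdeal R (Ideal.span (Set.range a)) :=
  isParameterIdeal_iff.mpr ⟨d, a, h, rfl⟩

lemma IsParamSystem.exists_pow_le [IsNoetherianRing R] {d : ℕ} {a : Fin d → R}
    (h : IsParamSystem a) : ∃ k, maximalIdeal R ^ k ≤ Ideal.span (Set.range a) :=
  Ideal.exists_pow_le_of_le_radical_of_fg h.le_radical (IsNoetherian.noetherian _)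

lemma IsParamSystem.of_le_radical {d : ℕ} {a b : Fin d → R} (h : IsParamSystem a)
    (hb : ∀ i, b i ∈ maximalIdeal R) (hab : ∀ i, a i ∈ (Ideal.span (Set.range b)).radical) :
    IsParamSystem b := by
  refine ⟨h.dim_eq, hb, h.le_radical.trans ?_⟩
  rw [Ideal.radical_le_radical_iff, Ideal.span_le]
  exact Set.range_subset_iff.mpr hab

lemma ringKrullDim_le_of_maximalIdeal_le_radical_span [IsNoetherianRing R] {n : ℕ} {b : Fin n → R}
    (hbm : ∀ i, b i ∈ maximalIdeal R)
    (hb : maximalIdeal R ≤ (Ideal.span (Set.range b)).radical) : ringKrullDim R ≤ n := by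
  classical
  rw [← maximalIdeal_height_eq_ringKrullDim]
  have hmin : maximalIdeal R ∈
      (Ideal.span ((Finset.univ.image b : Finset R) : Set R)).minimalPrimes := by
    rw [Finset.coe_image, Finset.coe_univ, Set.image_univ]
    refine ⟨⟨(maximalIdeal.isMaximal R).isPrime,
      Ideal.span_le.mpr (Set.range_subset_iff.mpr hbm)⟩, fun q hq _ => ?_⟩
    exact hb.trans ((Ideal.IsPrime.radical_le_iff hq.1).mpr hq.2)
  have hcard : ((Finset.univ.image b).card : ℕ∞) ≤ n := by
    exact_mod_cast Finset.card_image_le.trans (Finset.card_fin n).le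
  exact_mod_cast (Ideal.height_le_card_of_mem_minimalPrimes_span_finset hmin).trans hcard

end ParamSystem

section RegularParameters

variable {R : Type u} [CommRing R] [IsLocalRing R]

lemma IsParamSystem.pow_notMem [IsNoetherianRing R] {n : ℕ} {x : R} {b : Fin n → R}
    (h : IsParamSystem (Fin.cons x b : Fin (n + 1) → R)) (k : ℕ) :
    x ^ k ∉ Ideal.span (Set.range b) := by
  intro hx
  have hle : ringKrullDim R ≤ n := by
    refine ringKrullDim_le_of_maximalIdeal_le_radical_span (fun i => h.mem i.succ)
      (h.le_radical.trans ?_)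
    rw [Ideal.radical_le_radical_iff, span_range_cons]
    refine sup_le ((Ideal.span_singleton_le_iff_mem _).mpr ⟨k, hx⟩) Ideal.le_radical
  rw [h.dim_eq] at hle
  have : n + 1 ≤ n := by exact_mod_cast hle
  lia

/-- The condition that `Hom_R(R/I, R/J)` is cyclic for all parameter ideals `J ≤ I`, spelled out
in terms of elements. -/
def HomQuotientCyclic (R : Type u) [CommRing R] [IsLocalRing R] : Prop :=
  ∀ I J : Ideal R, IsParameterIdeal R I → IsParameterIdeal R J → J ≤ I →
    ∃ s : R, (∀ y ∈ I, s * y ∈ J) ∧ ∀ t : R, (∀ y ∈ I, t * y ∈ J) → ∃ c, t - c * s ∈ J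

/-- Every element of a system of parameters is a nonzerodivisor modulo the others. -/
def ParametersRegular (R : Type u) [CommRing R] [IsLocalRing R] : Prop :=
  ∀ (n : ℕ) (x : R) (b : Fin n → R), IsParamSystem (Fin.cons x b : Fin (n + 1) → R) →
    ∀ r, x * r ∈ Ideal.span (Set.range b) → r ∈ Ideal.span (Set.range b)

lemma IsParamSystem.cons_pow {n : ℕ} {x : R} {b : Fin n → R}
    (h : IsParamSystem (Fin.cons x b : Fin (n + 1) → R)) (k : ℕ) :
    IsParamSystem (Fin.cons (x ^ (k + 1)) b : Fin (n + 1) → R) := by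
  refine h.of_le_radical (Fin.cases ?_ fun i => h.mem i.succ) (Fin.cases ?_ fun i => ?_)
  · exact Ideal.pow_mem_of_mem _ (h.mem 0) _ k.succ_pos
  · exact ⟨k + 1, Ideal.subset_span ⟨0, rfl⟩⟩
  · exact Ideal.le_radical (Ideal.subset_span ⟨i.succ, rfl⟩)

lemma mem_of_forall_mem_span_pow_sup [IsNoetherianRing R] {J : Ideal R} {x r : R}
    (hx : x ∈ maximalIdeal R) (h : ∀ n, r ∈ Ideal.span {x ^ n} ⊔ J) : r ∈ J := by
  rw [← Ideal.Quotient.eq_zero_iff_mem]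
  refine IsHausdorff.haus (I := maximalIdeal R) inferInstance _ fun n => SModEq.zero.mpr ?_
  obtain ⟨y, hy, z, hz, rfl⟩ := Submodule.mem_sup.mp (h n)
  obtain ⟨a, rfl⟩ := Ideal.mem_span_singleton'.mp hy
  have : Ideal.Quotient.mk J (a * x ^ n + z) = (a * x ^ n) • (1 : R ⧸ J) := by
    rw [map_add, Ideal.Quotient.eq_zero_iff_mem.mpr hz, add_zero, Algebra.smul_def, mul_one]
    rfl
  rw [this]
  exact Submodule.smul_mem_smul (Ideal.mul_mem_left _ _ (Ideal.pow_mem_pow hx n)) trivial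

lemma HomQuotientCyclic.parametersRegular [IsNoetherianRing R] (H : HomQuotientCyclic R) :
    ParametersRegular R := by
  intro n x b h r hr
  refine mem_of_forall_mem_span_pow_sup (x := x) (h.mem 0) fun k => ?_
  set J := Ideal.span (Set.range b)
  have hmem : ∀ y z : R, z ∈ Ideal.span {y} ⊔ J ↔ ∃ a, ∃ j ∈ J, a * y + j = z := by
    intro y z
    simp only [Submodule.mem_sup, Ideal.mem_span_singleton']
    constructor
    · rintro ⟨_, ⟨a, rfl⟩, j, hj, h⟩
      exact ⟨a, j, hj, h⟩
    · rintro ⟨a, j, hj, h⟩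
      exact ⟨_, ⟨a, rfl⟩, j, hj, h⟩
  have hI := h.isParameterIdeal
  have hB := (h.cons_pow k).isParameterIdeal
  rw [span_range_cons] at hI hB
  obtain ⟨s, hs, hs'⟩ := H _ _ hI hB (sup_le_sup_right
    ((Ideal.span_singleton_le_iff_mem _).mpr (Ideal.mem_span_singleton.mpr
      (dvd_pow_self _ k.succ_ne_zero))) _)
  obtain ⟨β, j, hj, hβ⟩ := (hmem _ _).mp (hs x ((hmem _ _).mpr ⟨1, 0, J.zero_mem, by ring⟩))
  obtain ⟨c, hc⟩ := hs' (x ^ k) fun y hy => by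
    obtain ⟨a, i, hi, rfl⟩ := (hmem _ _).mp hy
    exact (hmem _ _).mpr ⟨a, x ^ k * i, J.mul_mem_left _ hi, by ring⟩
  obtain ⟨c', hc'⟩ := hs' r fun y hy => by
    obtain ⟨a, i, hi, rfl⟩ := (hmem _ _).mp hy
    exact (hmem _ _).mpr ⟨0, a * (x * r) + r * i,
      J.add_mem (J.mul_mem_left _ hr) (J.mul_mem_left _ hi), by ring⟩
  obtain ⟨γ, i, hi, hγ⟩ := (hmem _ _).mp hc
  obtain ⟨γ', i', hi', hγ'⟩ := (hmem _ _).mp hc'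
  by_cases hcu : IsUnit c
  · obtain ⟨u, hu⟩ := hcu.exists_left_inv
    refine (hmem _ _).mpr ⟨γ' * x + c' * u * (1 - γ * x), i' - c' * u * i,
      J.sub_mem hi' (J.mul_mem_left _ hi), ?_⟩
    have hr' : r = γ' * x ^ (k + 1) + i' + c' * s := by rw [hγ']; ring
    have hs' : s = u * (x ^ k - (γ * x ^ (k + 1) + i)) := by
      rw [hγ]; linear_combination (-s) * hu
    rw [hr', hs']
    ring
  · have hcβ : c * β + γ * x ∈ maximalIdeal R :=
      Ideal.add_mem _ (Ideal.mul_mem_right _ _ ((mem_maximalIdeal c).mpr hcu))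
        (Ideal.mul_mem_left _ _ (h.mem 0))
    obtain ⟨u, hu⟩ := (isUnit_one_sub_self_of_mem_nonunits _
      ((mem_maximalIdeal _).mp hcβ)).exists_left_inv
    refine absurd ?_ (h.pow_notMem (k + 1))
    have : x ^ (k + 1) = u * (c * j + x * i) := by
      linear_combination (-x ^ (k + 1)) * hu - u * c * hβ - u * x * hγ
    rw [this]
    exact J.mul_mem_left _ (J.add_mem (J.mul_mem_left _ hj) (J.mul_mem_left _ hi))

lemma ParametersRegular.mem_nonZeroDivisors [IsNoetherianRing R] (P : ParametersRegular R) {n : ℕ}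
    {x : R} {b : Fin n → R} (h : IsParamSystem (Fin.cons x b : Fin (n + 1) → R)) :
    x ∈ nonZeroDivisors R := by
  refine mem_nonZeroDivisors_iff_right.mpr fun r hr => ?_
  have key : ∀ k, r ∈ maximalIdeal R ^ (k + 1) := by
    intro k
    have hk : IsParamSystem (Fin.cons x (fun i => b i ^ (k + 1)) : Fin (n + 1) → R) := by
      refine h.of_le_radical (Fin.cases (h.mem 0) fun i => ?_) (Fin.cases ?_ fun i => ?_)
      · exact Ideal.pow_mem_of_mem _ (h.mem i.succ) _ k.succ_pos
      · exact Ideal.le_radical (Ideal.subset_span ⟨0, rfl⟩)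
      · exact ⟨k + 1, Ideal.subset_span ⟨i.succ, rfl⟩⟩
    refine Ideal.span_le.mpr (Set.range_subset_iff.mpr fun i => ?_)
      (P n x _ hk r (by rw [mul_comm, hr]; exact Ideal.zero_mem _))
    exact Ideal.pow_mem_pow (h.mem i.succ) _
  have hbot := Ideal.iInf_pow_eq_bot_of_isLocalRing (maximalIdeal R)
    (maximalIdeal.isMaximal R).ne_top
  rw [← Ideal.mem_bot, ← hbot, Ideal.mem_iInf]
  exact fun k => Ideal.pow_le_pow_right k.le_succ (key k)

lemma comap_span_range_mk {R : Type*} [CommRing R] (x : R) {n : ℕ} (c : Fin n → R) :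
    (Ideal.span (Set.range (Ideal.Quotient.mk (Ideal.span {x}) ∘ c))).comap
      (Ideal.Quotient.mk (Ideal.span {x})) = Ideal.span {x} ⊔ Ideal.span (Set.range c) := by
  rw [Set.range_comp, ← Ideal.map_span,
    Ideal.comap_map_of_surjective' _ Ideal.Quotient.mk_surjective, Ideal.mk_ker, sup_comm]

lemma isLocalRing_quotient {x : R} (hx : x ∈ maximalIdeal R) :
    IsLocalRing (R ⧸ Ideal.span {x}) := by
  have : Nontrivial (R ⧸ Ideal.span {x}) := Ideal.Quotient.nontrivial_iff.mpr
    (ne_top_of_le_ne_top (maximalIdeal.isMaximal R).ne_top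
      ((Ideal.span_singleton_le_iff_mem _).mpr hx))
  exact IsLocalRing.of_surjective' _ Ideal.Quotient.mk_surjective

lemma isParamSystem_mk_comp_iff [IsNoetherianRing R] {x : R} (hx : x ∈ nonZeroDivisors R)
    (hxm : x ∈ maximalIdeal R) [IsLocalRing (R ⧸ Ideal.span {x})] {n : ℕ} {c : Fin n → R} :
    IsParamSystem (Ideal.Quotient.mk (Ideal.span {x}) ∘ c) ↔
      IsParamSystem (Fin.cons x c : Fin (n + 1) → R) := by
  have hdim : ringKrullDim (R ⧸ Ideal.span {x}) = n ↔ ringKrullDim R = (n + 1 : ℕ) := by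
    rw [← ringKrullDim_quotient_span_singleton_succ_eq_ringKrullDim_of_mem_nonZeroDivisors hx hxm]
    push_cast
    exact ENat.WithBot.add_one_cancel.symm
  have hrad : maximalIdeal (R ⧸ Ideal.span {x}) ≤
        (Ideal.span (Set.range (Ideal.Quotient.mk (Ideal.span {x}) ∘ c))).radical ↔
      maximalIdeal R ≤ (Ideal.span (Set.range (Fin.cons x c : Fin (n + 1) → R))).radical := by
    rw [← map_mk_maximalIdeal, Ideal.map_le_iff_le_comap, Ideal.comap_radical,
      comap_span_range_mk, span_range_cons]
  constructor
  · rintro ⟨h1, h2, h3⟩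
    exact ⟨hdim.mp h1, Fin.cases hxm fun i => mk_mem_maximalIdeal_iff.mp (h2 i), hrad.mp h3⟩
  · rintro ⟨h1, h2, h3⟩
    exact ⟨hdim.mpr h1, fun i => mk_mem_maximalIdeal_iff.mpr (h2 i.succ), hrad.mpr h3⟩

lemma ParametersRegular.quotient [IsNoetherianRing R] (P : ParametersRegular R) {x : R}
    (hx : x ∈ nonZeroDivisors R) (hxm : x ∈ maximalIdeal R) [IsLocalRing (R ⧸ Ideal.span {x})] :
    ParametersRegular (R ⧸ Ideal.span {x}) := by
  intro n y c h r hr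
  obtain ⟨y, rfl⟩ := Ideal.Quotient.mk_surjective y
  obtain ⟨r, rfl⟩ := Ideal.Quotient.mk_surjective r
  obtain ⟨c, rfl⟩ := Ideal.Quotient.mk_surjective.comp_left (α := Fin n) c
  have hcons : (Fin.cons (Ideal.Quotient.mk (Ideal.span {x}) y)
      (Ideal.Quotient.mk (Ideal.span {x}) ∘ c) : Fin (n + 1) → R ⧸ Ideal.span {x}) =
      Ideal.Quotient.mk (Ideal.span {x}) ∘ (Fin.cons y c : Fin (n + 1) → R) := by
    funext i
    refine Fin.cases rfl (fun i => rfl) i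
  rw [hcons, isParamSystem_mk_comp_iff hx hxm] at h
  have h' : IsParamSystem (Fin.cons y (Fin.cons x c : Fin (n + 1) → R) : Fin (n + 2) → R) := by
    refine h.of_le_radical (Fin.cases (h.mem 1) (Fin.cases (h.mem 0) fun i => h.mem i.succ.succ))
      (Fin.cases ?_ (Fin.cases ?_ fun i => ?_))
    · exact Ideal.le_radical (Ideal.subset_span ⟨1, rfl⟩)
    · exact Ideal.le_radical (Ideal.subset_span ⟨0, rfl⟩)
    · exact Ideal.le_radical (Ideal.subset_span ⟨i.succ.succ, rfl⟩)
  have key := P _ _ _ h' r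
  rw [span_range_cons, ← comap_span_range_mk, Ideal.mem_comap, Ideal.mem_comap, map_mul] at key
  exact key hr

lemma ParametersRegular.residueExtVanishes {d : ℕ} : ∀ {R : Type u} [CommRing R]
    [IsNoetherianRing R] [IsLocalRing R], ParametersRegular R → ∀ {a : Fin d → R},
    IsParamSystem a → IsIrreducibleIdeal (Ideal.span (Set.range a)) → ResidueExtVanishes R := by
  induction d with
  | zero =>
    intro R _ _ _ _ a ha hirr
    obtain ⟨k, hk⟩ := ha.exists_pow_le
    obtain ⟨σ, hσ⟩ := hirr.exists_isSocleGenerator hk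
    rw [Set.range_eq_empty, Ideal.span_empty] at hσ hk
    have := injective_of_isSocleGenerator hσ (le_bot_iff.mp hk)
    refine ⟨1, fun i hi => ?_⟩
    obtain ⟨i, rfl⟩ := Nat.exists_eq_add_of_le' hi
    exact ExtVanishes.of_injective_right i
  | succ d ih =>
    intro R _ _ _ P a ha hirr
    obtain ⟨x, c, rfl⟩ : ∃ x c, a = (Fin.cons x c : Fin (d + 1) → R) :=
      ⟨a 0, Fin.tail a, (Fin.cons_self_tail a).symm⟩
    have hxm : x ∈ maximalIdeal R := ha.mem 0
    have hx := P.mem_nonZeroDivisors ha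
    have := isLocalRing_quotient hxm
    rw [span_range_cons, ← comap_span_range_mk, isIrreducibleIdeal_comap_mk_iff] at hirr
    exact (residueExtVanishes_quotient_iff hx).mp
      (ih (P.quotient hx hxm) ((isParamSystem_mk_comp_iff hx hxm).mpr ha) hirr)

end RegularParameters

section IrreducibleParameters

variable {R : Type u} [CommRing R] [IsLocalRing R]

lemma exists_mem_nonZeroDivisors_notMem_mul [IsNoetherianRing R] {I : Ideal R}
    (hI : I ≠ ⊥) {k : ℕ} (hk : maximalIdeal R ^ k ≤ I)
    (hsoc : ∀ σ : R, (∀ x ∈ maximalIdeal R, x * σ = 0) → σ = 0) :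
    ∃ z ∈ I, z ∈ nonZeroDivisors R ∧ z ∉ maximalIdeal R * I := by
  by_contra! hcon
  have hsub : (I : Set R) ⊆
      ⋃ p ∈ insert (maximalIdeal R * I) (associatedPrimes R R), (p : Set R) := by
    intro z hz
    rw [Set.biUnion_insert, biUnion_associatedPrimes_eq_compl_nonZeroDivisors]
    by_cases hz' : z ∈ nonZeroDivisors R
    · exact Or.inl (hcon z hz hz')
    · exact Or.inr hz'
  obtain ⟨p, hp, hIp⟩ := (I.subset_union_prime_finite
    ((associatedPrimes.finite R R).insert (maximalIdeal R * I)) (f := id) (maximalIdeal R * I)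
    (maximalIdeal R * I) fun p hp hne _ => (hp.resolve_left hne).isPrime).mp hsub
  obtain rfl | hp := hp
  · exact hI (Submodule.eq_bot_of_le_smul_of_le_jacobson_bot (maximalIdeal R) I
      (IsNoetherian.noetherian _) hIp (maximalIdeal_le_jacobson _))
  · have hprime := hp.isPrime
    have hmp : maximalIdeal R ≤ p := fun x hx =>
      hprime.mem_of_pow_mem k (hIp (hk (Ideal.pow_mem_pow hx k)))
    obtain ⟨-, σ, hσ⟩ := (isAssociatedPrime_iff).mp hp
    have hσ0 := hsoc σ fun x hx => by
      have := hmp hx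
      rwa [hσ, Submodule.mem_colon_singleton, smul_eq_mul, Submodule.mem_bot] at this
    refine hprime.ne_top ((Ideal.eq_top_iff_one _).mpr ?_)
    rw [hσ, Submodule.mem_colon_singleton, hσ0, smul_zero]
    exact Submodule.zero_mem _

lemma exists_span_eq_sup_of_notMem_mul {n : ℕ} {a : Fin (n + 1) → R} {z : R}
    (hz : z ∈ Ideal.span (Set.range a)) (hz' : z ∉ maximalIdeal R * Ideal.span (Set.range a)) :
    ∃ i : Fin (n + 1),
      Ideal.span (Set.range a) = Ideal.span {z} ⊔ Ideal.span (Set.range (a ∘ i.succAbove)) := by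
  obtain ⟨c, rfl⟩ := Ideal.mem_span_range_iff_exists_fun.mp hz
  have hi : ∃ i, IsUnit (c i) := by
    by_contra! h
    exact hz' (Ideal.sum_mem _ fun i _ => Ideal.mul_mem_mul ((mem_maximalIdeal _).mpr (h i))
      (Ideal.subset_span ⟨i, rfl⟩))
  obtain ⟨i, hi⟩ := hi
  refine ⟨i, le_antisymm ?_ ?_⟩
  · have hj : ∀ j, a (i.succAbove j) ∈ Ideal.span {∑ i, c i * a i} ⊔
        Ideal.span (Set.range (a ∘ i.succAbove)) :=
      fun j => Ideal.mem_sup_right (Ideal.subset_span ⟨j, rfl⟩)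
    refine Ideal.span_le.mpr (Set.range_subset_iff.mpr
      ((Fin.forall_iff_succAbove i).mpr ⟨?_, hj⟩))
    refine (Ideal.unit_mul_mem_iff_mem _ hi).mp ?_
    rw [← add_sub_cancel_right (c i * a i) (∑ j, c (i.succAbove j) * a (i.succAbove j)),
      ← Fin.sum_univ_succAbove (fun i => c i * a i)]
    exact Ideal.sub_mem _ (Ideal.mem_sup_left (Ideal.mem_span_singleton_self _))
      (Ideal.sum_mem _ fun j _ => Ideal.mul_mem_left _ _ (hj j))
  · exact sup_le ((Ideal.span_singleton_le_iff_mem _).mpr hz)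
      (Ideal.span_mono (Set.range_comp_subset_range _ _))

lemma ResidueExtVanishes.isIrreducibleIdeal {d : ℕ} : ∀ {R : Type u} [CommRing R]
    [IsNoetherianRing R] [IsLocalRing R], ResidueExtVanishes R → ∀ {a : Fin d → R},
    IsParamSystem a → IsIrreducibleIdeal (Ideal.span (Set.range a)) := by
  induction d with
  | zero =>
    intro R _ _ _ H a ha
    obtain ⟨k, hk⟩ := ha.exists_pow_le
    rw [Set.range_eq_empty, Ideal.span_empty] at hk ⊢
    obtain ⟨σ, hσ, hmσ⟩ := exists_mul_notMem_of_pow_le hk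
      (a := (1 : R)) (by rw [Ideal.mem_bot]; exact one_ne_zero)
    rw [Ideal.mem_bot] at hσ
    simp only [Ideal.mem_bot] at hmσ
    have := injective_of_residueExtVanishes H hσ hmσ
    exact (isSocleGenerator_of_injective hσ hmσ).isIrreducibleIdeal hk
  | succ d ih =>
    intro R _ _ _ H a ha
    have hdim : ¬ maximalIdeal R ≤ (⊥ : Ideal R).radical := by
      intro hle
      have := ringKrullDim_le_of_maximalIdeal_le_radical_span (R := R) (b := Fin.elim0)
        (fun i => i.elim0) (by rwa [Set.range_eq_empty, Ideal.span_empty])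
      rw [ha.dim_eq] at this
      have : d + 1 ≤ 0 := by exact_mod_cast this
      lia
    have hsoc : ∀ σ : R, (∀ x ∈ maximalIdeal R, x * σ = 0) → σ = 0 := by
      intro σ hmσ
      by_contra hσ
      have := injective_of_residueExtVanishes H hσ hmσ
      exact hdim fun x hx => isNilpotent_of_injective hx
    obtain ⟨k, hk⟩ := ha.exists_pow_le
    have hbot : Ideal.span (Set.range a) ≠ ⊥ := fun h => hdim (h ▸ ha.le_radical)
    obtain ⟨z, hz, hz0, hzm⟩ := exists_mem_nonZeroDivisors_notMem_mul hbot hk hsoc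
    obtain ⟨i, hi⟩ := exists_span_eq_sup_of_notMem_mul hz hzm
    have hzm : z ∈ maximalIdeal R := ha.span_le hz
    have hcons : IsParamSystem (Fin.cons z (a ∘ i.succAbove) : Fin (d + 1) → R) := by
      refine ha.of_le_radical (Fin.cases hzm fun j => ha.mem _) fun j => Ideal.le_radical ?_
      rw [span_range_cons, ← hi]
      exact Ideal.subset_span ⟨j, rfl⟩
    have := isLocalRing_quotient hzm
    rw [hi, ← comap_span_range_mk, isIrreducibleIdeal_comap_mk_iff]
    exact ih ((residueExtVanishes_quotient_iff hz0).mpr H)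
      ((isParamSystem_mk_comp_iff hz0 hzm).mpr hcons)

lemma ResidueExtVanishes.homQuotientCyclic [IsNoetherianRing R] (H : ResidueExtVanishes R) :
    HomQuotientCyclic R := by
  intro I J hI hJ hJI
  obtain ⟨d, a, ha, rfl⟩ := isParameterIdeal_iff.mp hI
  obtain ⟨e, b, hb, rfl⟩ := isParameterIdeal_iff.mp hJ
  obtain ⟨k, hk⟩ := hb.exists_pow_le
  obtain ⟨σ, hσ⟩ := (H.isIrreducibleIdeal hb).exists_isSocleGenerator hk
  obtain ⟨τ, hτ⟩ := (H.isIrreducibleIdeal ha).exists_isSocleGenerator (hk.trans hJI)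
  set I := Ideal.span (Set.range a)
  set J := Ideal.span (Set.range b)
  have hnt : Nontrivial (R ⧸ J) := Ideal.Quotient.nontrivial_iff.mpr
    (ne_top_of_le_ne_top (maximalIdeal.isMaximal R).ne_top hb.span_le)
  have : IsLocalRing (R ⧸ J) := IsLocalRing.of_surjective' _ Ideal.Quotient.mk_surjective
  have hpow : maximalIdeal (R ⧸ J) ^ k = ⊥ := by
    rw [← map_mk_maximalIdeal, ← Ideal.map_pow, Ideal.map_eq_bot_iff_le_ker, Ideal.mk_ker]
    exact hk
  have hinj := injective_of_isSocleGenerator hσ.quotient hpow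
  have mem_map : ∀ y, Ideal.Quotient.mk J y ∈ I.map (Ideal.Quotient.mk J) ↔ y ∈ I := fun y => by
    rw [← Ideal.mem_comap, Ideal.comap_map_of_surjective' _ Ideal.Quotient.mk_surjective,
      Ideal.mk_ker, sup_eq_left.mpr hJI]
  obtain ⟨s, hs, hsτ⟩ : ∃ s : R, (∀ y ∈ I, s * y ∈ J) ∧ s * τ ∉ J := by
    by_contra! hcon
    refine hτ.notMem ((mem_map τ).mp ((isAnnihilatorDual_of_isSocleGenerator hσ.quotient hpow
      (I.map (Ideal.Quotient.mk J))).mem _ fun t ht => ?_))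
    obtain ⟨t, rfl⟩ := Ideal.Quotient.mk_surjective t
    rw [← map_mul, Ideal.Quotient.eq_zero_iff_mem]
    refine hcon t fun y hy => ?_
    rw [← Ideal.Quotient.eq_zero_iff_mem, map_mul]
    exact ht _ ((mem_map y).mpr hy)
  refine ⟨s, hs, fun t ht => ?_⟩
  obtain ⟨c, hc⟩ := exists_eq_mul_of_injective (a := Ideal.Quotient.mk J s)
    (b := Ideal.Quotient.mk J t) fun r hr => by
      obtain ⟨r, rfl⟩ := Ideal.Quotient.mk_surjective r
      rw [← map_mul, Ideal.Quotient.eq_zero_iff_mem] at hr ⊢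
      refine ht r ?_
      by_contra hrI
      obtain ⟨c, hc⟩ := hτ.exists_mul_sub_mem (hk.trans hJI) hrI
      refine hsτ ?_
      have : s * τ = c * (s * r) - s * (c * r - τ) := by ring
      rw [this]
      exact J.sub_mem (J.mul_mem_left _ hr) (hs _ hc)
  obtain ⟨c, rfl⟩ := Ideal.Quotient.mk_surjective c
  exact ⟨c, Ideal.Quotient.eq.mp (by rw [hc, map_mul])⟩

lemma exists_isParamSystem (R : Type u) [CommRing R] [IsNoetherianRing R] [IsLocalRing R] :
    ∃ (d : ℕ) (a : Fin d → R), IsParamSystem a := by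
  obtain ⟨s, hs, hcard⟩ :=
    Ideal.exists_finset_card_eq_height_of_isNoetherianRing (maximalIdeal R)
  have hrange : Set.range (fun i => (s.equivFin.symm i : R)) = s := by
    rw [← Function.comp_def, s.equivFin.symm.surjective.range_comp, Subtype.range_coe]
  refine ⟨s.card, fun i => s.equivFin.symm i, ?_, fun i => ?_, ?_⟩
  · rw [← maximalIdeal_height_eq_ringKrullDim, ← hcard]
    rfl
  · exact hs.1.2 (Ideal.subset_span (s.equivFin.symm i).2)
  · rw [hrange, Ideal.radical_eq_sInf]
    refine le_sInf fun p hp => hs.2 ⟨hp.2, hp.1⟩ ?_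
    exact le_maximalIdeal hp.2.ne_top

end IrreducibleParameters


theorem gorenstein_iff_hom_quotient_cyclic_and_exists_irreducible_parameter (R : Type*) [CommRing R] [IsNoetherianRing R] [IsLocalRing R] :
    HasFiniteInjectiveDimension R ↔
      ((∀ a b : Ideal R, IsParameterIdeal R a → IsParameterIdeal R b → b ≤ a →
          Submodule.IsPrincipal (⊤ : Submodule R ((R ⧸ a) →ₗ[R] (R ⧸ b)))) ∧
        ∃ I : Ideal R, IsParameterIdeal R I ∧ IsIrreducibleIdeal I) := by
  simp_rw [isPrincipal_top_hom_quotient_iff]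
  rw [hasFiniteInjectiveDimension_iff_residueExtVanishes]
  constructor
  · intro H
    obtain ⟨d, a, ha⟩ := exists_isParamSystem R
    exact ⟨H.homQuotientCyclic, _, ha.isParameterIdeal, H.isIrreducibleIdeal ha⟩
  · rintro ⟨H, I, hI, hirr⟩
    obtain ⟨d, a, ha, rfl⟩ := isParameterIdeal_iff.mp hI
    exact (HomQuotientCyclic.parametersRegular H).residueExtVanishes ha hirr
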